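/- There exists an absolute constant c > 0 with the following property. Let F be a field and let A ⊆ F² be a finite nonempty set; if F has positive characteristic p, assume in addition |A| ≤ p^{4/3}. Then either A is contained in a single isotropic line (so all pairwise distances between points of A are zero), or Δ_pin(A) ≥ c·|A|^{2/3}. -/

import Mathlib

namespace Stmt3

/-- The (algebraic) squared distance in the plane `F²`. -/
def dist2 {F : Type*} [CommRing F] (x y : F × F) : F :=
  (x.1 - y.1) ^ 2 + (x.2 - y.2) ^ 2

/-- The dot product on `F²`. -/
def dot {F : Type*} [CommRing F] (x y : F × F) : F :=
  x.1 * y.1 + x.2 * y.2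

/-- An isotropic line in `F²`: a line whose direction vector `v` satisfies `v·v = 0`. -/
def IsIsotropicLine {F : Type*} [CommRing F] (L : Set (F × F)) : Prop :=
  ∃ x v : F × F, v ≠ 0 ∧ dot v v = 0 ∧ L = {y | ∃ t : F, y = x + t • v}

/-- `Δ(A;x)`, the number of distances from the pin `x` to points of `A`. -/
noncomputable def pinnedCount {F : Type*} [CommRing F] (A : Finset (F × F)) (x : F × F) : ℕ :=
  Set.ncard ((fun a => dist2 a x) '' (A : Set (F × F)))

/-- `Δ_pin(A) = max_{x ∈ A} Δ(A;x)`. -/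
noncomputable def pinnedMax {F : Type*} [CommRing F] (A : Finset (F × F)) : ℕ :=
  A.sup (fun x => pinnedCount A x)

section Polynomials
open MvPolynomial

theorem six_mul_sum_choose (T : ℕ) :
    6 * ∑ t ∈ Finset.range (T + 1), (3 + t - 1).choose t = (T + 1) * (T + 2) * (T + 3) := by
  induction T with
  | zero => simp
  | succ T ih =>
    rw [Finset.sum_range_succ, mul_add, ih]
    have h : (3 + (T + 1) - 1).choose (T + 1) = (T + 3).choose 2 := by
      rw [show 3 + (T + 1) - 1 = T + 3 by omega]
      exact Nat.choose_symm_of_eq_add (by omega)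
    have h2 : (T + 3).choose 2 * 2 = (T + 3) * (T + 2) := by
      rw [Nat.choose_two_right]
      exact Nat.div_mul_cancel (even_iff_two_dvd.mp (Nat.even_mul_pred_self (T + 3)))
    rw [h]
    linear_combination 3 * h2

theorem six_mul_finrank_restrictTotalDegree (K : Type*) [Field K] (T : ℕ) :
    6 * Module.finrank K (restrictTotalDegree (Fin 3) K T) = (T + 1) * (T + 2) * (T + 3) := by
  classical
  set s : Set (Fin 3 →₀ ℕ) := {n | (n.sum fun _ e => e) ≤ T} with hs
  have h1 : Module.finrank K (restrictTotalDegree (Fin 3) K T) = Nat.card s :=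
    Module.finrank_eq_nat_card_basis (basisRestrictSupport K s)
  have h2 : s = ((Finset.range (T + 1)).biUnion
      fun t => (Finset.univ : Finset (Fin 3)).finsuppAntidiag t : Finset (Fin 3 →₀ ℕ)) := by
    ext n
    simp only [hs, Set.mem_ofPred_eq, Finset.coe_biUnion, Set.mem_iUnion, Finset.mem_coe,
      Finset.mem_range, Finset.mem_finsuppAntidiag', Finset.subset_univ, and_true]
    constructor
    · intro h
      exact ⟨_, Nat.lt_succ_of_le h, rfl⟩
    · rintro ⟨t, ht, h⟩
      exact h.le.trans (Nat.lt_succ_iff.mp ht)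
  rw [h1, h2, Nat.card_coe_set_eq, Set.ncard_coe_finset, Finset.card_biUnion]
  · simpa [Finset.card_finsuppAntidiag_nat_eq_choose] using six_mul_sum_choose T
  · intro a _ b _ hab
    rw [Function.onFun, Finset.disjoint_left]
    intro n hn hn'
    simp only [Finset.mem_finsuppAntidiag] at hn hn'
    exact hab (hn.1.symm.trans hn'.1)

variable {K : Type*} [Field K]

theorem mul_mem_restrictTotalDegree {f g : MvPolynomial (Fin 3) K} {a b : ℕ}
    (hf : f.totalDegree ≤ a) (hg : g ∈ restrictTotalDegree (Fin 3) K b) :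
    f * g ∈ restrictTotalDegree (Fin 3) K (a + b) := by
  rw [mem_restrictTotalDegree] at *
  exact (totalDegree_mul _ _).trans (add_le_add hf hg)

/-- A Hilbert function bound for the common zeros of two coprime polynomials. -/
theorem card_common_zeros_le {f g : MvPolynomial (Fin 3) K} (hf : f ≠ 0) (hg : g ≠ 0)
    (hfg : IsRelPrime f g) {T a b : ℕ} (ha : f.totalDegree = a) (hb : g.totalDegree = b)
    (X : Finset (Fin 3 → K)) (hX : ∀ x ∈ X, eval x f = 0 ∧ eval x g = 0)
    (hsep : ∀ x ∈ X, ∃ h : MvPolynomial (Fin 3) K, h.totalDegree ≤ T + a + b ∧ eval x h ≠ 0 ∧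
      ∀ y ∈ X, y ≠ x → eval y h = 0) :
    X.card + Module.finrank K (restrictTotalDegree (Fin 3) K (T + b)) +
      Module.finrank K (restrictTotalDegree (Fin 3) K (T + a)) ≤
      Module.finrank K (restrictTotalDegree (Fin 3) K (T + a + b)) +
      Module.finrank K (restrictTotalDegree (Fin 3) K T) := by
  classical
  let ev : MvPolynomial (Fin 3) K →ₗ[K] (X → K) := LinearMap.pi fun x => (aeval x.1).toLinearMap
  have hev : ∀ p x, ev p x = eval x.1 p := fun p x => by simp [ev, aeval_eq_eval]
  let evT := ev.domRestrict (restrictTotalDegree (Fin 3) K (T + a + b))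
  have hsurj : Function.Surjective evT := by
    rw [← LinearMap.range_eq_top, eq_top_iff, ← (Pi.basisFun K X).span_eq, Submodule.span_le]
    rintro _ ⟨x, rfl⟩
    obtain ⟨h, hd, hx, hy⟩ := hsep x.1 x.2
    refine ⟨(eval x.1 h)⁻¹ • ⟨h, (mem_restrictTotalDegree _ _ _).mpr hd⟩, ?_⟩
    ext y
    by_cases hxy : y = x
    · subst hxy
      simp [evT, hev, hx]
    · have : (y : Fin 3 → K) ≠ x := fun h => hxy (Subtype.ext h)
      simp [evT, hev, hxy, hy y y.2 this]
  have hrk := LinearMap.finrank_range_add_finrank_ker evT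
  rw [LinearMap.range_eq_top.mpr hsurj, finrank_top, Module.finrank_fintype_fun_eq_card,
    Fintype.card_coe] at hrk
  let mf := LinearMap.mulLeft K f
  let mg := LinearMap.mulLeft K g
  have hmf : Function.Injective mf := mul_right_injective₀ hf
  have hmg : Function.Injective mg := mul_right_injective₀ hg
  let I₁ := (restrictTotalDegree (Fin 3) K (T + b)).map mf
  let I₂ := (restrictTotalDegree (Fin 3) K (T + a)).map mg
  have h1 : Module.finrank K I₁ = Module.finrank K (restrictTotalDegree (Fin 3) K (T + b)) :=
    (Submodule.equivMapOfInjective mf hmf _).finrank_eq.symm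
  have h2 : Module.finrank K I₂ = Module.finrank K (restrictTotalDegree (Fin 3) K (T + a)) :=
    (Submodule.equivMapOfInjective mg hmg _).finrank_eq.symm
  have h3 : Module.finrank K (I₁ ⊓ I₂ : Submodule K _) ≤ Module.finrank K (restrictTotalDegree (Fin 3) K T) := by
    have hle : I₁ ⊓ I₂ ≤ (restrictTotalDegree (Fin 3) K T).map (LinearMap.mulLeft K (f * g)) := by
      rintro _ ⟨⟨p, hp, rfl⟩, ⟨q, hq, hpq⟩⟩
      change g * q = f * p at hpq
      obtain ⟨k, rfl⟩ : g ∣ p := by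
        refine hfg.symm.dvd_of_dvd_mul_left (?_ : g ∣ f * p)
        exact ⟨q, hpq.symm⟩
      refine ⟨k, ?_, by simp [mf]⟩
      by_cases hk : k = 0
      · subst hk; exact Submodule.zero_mem _
      simp only [SetLike.mem_coe, mem_restrictTotalDegree] at hp ⊢
      rw [totalDegree_mul_of_isDomain hg hk] at hp
      omega
    exact (Submodule.finrank_mono hle).trans (Submodule.finrank_map_le _ _)
  have h4 : Module.finrank K (I₁ ⊔ I₂ : Submodule K _) ≤ Module.finrank K (LinearMap.ker evT) := by
    have hle : I₁ ⊔ I₂ ≤ (LinearMap.ker evT).map (restrictTotalDegree (Fin 3) K (T + a + b)).subtype := by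
      rw [sup_le_iff]
      constructor
      · rintro _ ⟨p, hp, rfl⟩
        refine ⟨⟨f * p, ?_⟩, ?_, rfl⟩
        · have := mul_mem_restrictTotalDegree ha.le hp
          rwa [show a + (T + b) = T + a + b by ring] at this
        · ext x
          simp [evT, hev, (hX x.1 x.2).1]
      · rintro _ ⟨p, hp, rfl⟩
        refine ⟨⟨g * p, ?_⟩, ?_, rfl⟩
        · have := mul_mem_restrictTotalDegree hb.le hp
          rwa [show b + (T + a) = T + a + b by ring] at this
        · ext x
          simp [evT, hev, (hX x.1 x.2).2]
    exact (Submodule.finrank_mono hle).trans (Submodule.finrank_map_le _ _)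
  have h5 := Submodule.finrank_sup_add_finrank_inf_eq I₁ I₂
  omega

/-- The point with first coordinate `s` on the line through `(0, u, v)` with direction
`(1, σ, σ²)`, where `l = (σ, u, v)`. -/
def linePoint (l : K × K × K) (s : K) : Fin 3 → K :=
  ![s, l.2.1 + l.1 * s, l.2.2 + l.1 ^ 2 * s]

theorem linePoint_injective_of_ne {l l' : K × K × K} (h : l ≠ l') :
    {s : K | linePoint l s = linePoint l' s}.Subsingleton := by
  intro s hs t ht
  simp only [linePoint, Set.mem_ofPred_eq] at hs ht
  have e1 := congrFun hs 1
  have e2 := congrFun hs 2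
  have e3 := congrFun ht 1
  have e4 := congrFun ht 2
  simp at e1 e2 e3 e4
  by_contra hst
  have hσ : l.1 = l'.1 := by
    have : (l.1 - l'.1) * (s - t) = 0 := by linear_combination e1 - e3
    rcases mul_eq_zero.mp this with h | h
    · exact sub_eq_zero.mp h
    · exact absurd (sub_eq_zero.mp h) hst
  rw [hσ] at e1 e2
  exact h (Prod.ext hσ (Prod.ext (add_right_cancel e1) (add_right_cancel e2)))

/-- Two coprime polynomials of degrees `a` and `b` vanish together on at most `a * b` lines. -/
theorem card_common_lines_le [Infinite K] {f g : MvPolynomial (Fin 3) K} (hf : f ≠ 0) (hg : g ≠ 0)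
    (hfg : IsRelPrime f g) (L : Finset (K × K × K))
    (hL : ∀ l ∈ L, ∀ s, eval (linePoint l s) f = 0 ∧ eval (linePoint l s) g = 0) :
    L.card ≤ f.totalDegree * g.totalDegree := by
  classical
  by_contra! hlt
  set a := f.totalDegree with ha
  set b := g.totalDegree with hb
  obtain ⟨M, hML, hM⟩ := Finset.exists_subset_card_eq (Nat.succ_le_of_lt hlt)
  set m := a * b + 1 with hm
  have hbad : {s : K | ∃ l ∈ M, ∃ l' ∈ M, l ≠ l' ∧ linePoint l s = linePoint l' s}.Finite := by
    have : {s : K | ∃ l ∈ M, ∃ l' ∈ M, l ≠ l' ∧ linePoint l s = linePoint l' s} =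
        ⋃ l ∈ M, ⋃ l' ∈ M, {s : K | l ≠ l' ∧ linePoint l s = linePoint l' s} := by
      ext s
      simp only [Set.mem_ofPred_eq, Set.mem_iUnion, exists_prop]
    rw [this]
    refine M.finite_toSet.biUnion fun l _ => M.finite_toSet.biUnion fun l' _ => ?_
    by_cases h : l = l'
    · simp [h]
    · exact ((linePoint_injective_of_ne h).anti fun s hs => hs.2).finite
  set N := 2 * m * m + a + b + m with hN
  obtain ⟨S, hS, hSc⟩ := hbad.infinite_compl.exists_subset_card_eq N
  have hgood : ∀ s ∈ S, ∀ l ∈ M, ∀ l' ∈ M, linePoint l s = linePoint l' s → l = l' := by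
    intro s hs l hl l' hl' h
    by_contra hne
    exact hS hs ⟨l, hl, l', hl', hne, h⟩
  set Pts := (M ×ˢ S).image fun q => linePoint q.1 q.2 with hPts
  have hPc : Pts.card = m * N := by
    rw [hPts, Finset.card_image_of_injOn, Finset.card_product, hM, hSc]
    rintro ⟨l, s⟩ h ⟨l', s'⟩ h' heq
    simp only [Finset.coe_product, Set.mem_prod, Finset.mem_coe] at h h' heq
    have hs : s = s' := by simpa [linePoint] using congrFun heq 0
    subst hs
    rw [hgood s h.2 l h.1 l' h'.1 heq]
  obtain ⟨T, hT⟩ : ∃ T, T + a + b = m + N := ⟨2 * m * m + m + m, by omega⟩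
  have hcard := card_common_zeros_le (T := T) hf hg hfg ha.symm hb.symm Pts (by
    intro x hx
    obtain ⟨⟨l, s⟩, hls, rfl⟩ := Finset.mem_image.mp hx
    exact hL l (hML (Finset.mem_product.mp hls).1) s) (by
    intro x hx
    obtain ⟨⟨l, s⟩, hls, rfl⟩ := Finset.mem_image.mp hx
    obtain ⟨hl, hs⟩ := Finset.mem_product.mp hls
    simp only at hl hs
    have hsepl : ∀ l' : K × K × K, ∃ q : MvPolynomial (Fin 3) K, q.totalDegree ≤ 1 ∧
        (l' ∈ M → l' ≠ l → eval (linePoint l s) q ≠ 0 ∧ eval (linePoint l' s) q = 0) := by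
      intro l'
      by_cases hl' : l' ∈ M ∧ l' ≠ l
      · have hne : linePoint l s ≠ linePoint l' s :=
          fun h => hl'.2 (hgood s hs l hl l' hl'.1 h).symm
        obtain ⟨i, hi⟩ := Function.ne_iff.mp hne
        refine ⟨X i - C (linePoint l' s i), ?_, fun _ _ => ⟨?_, ?_⟩⟩
        · exact (totalDegree_sub_C_le _ _).trans (totalDegree_X _).le
        · simpa [sub_eq_zero] using hi
        · simp
      · exact ⟨0, by simp, fun h h' => absurd ⟨h, h'⟩ hl'⟩
    choose q hq1 hq2 using hsepl
    refine ⟨(∏ l' ∈ M.erase l, q l') * ∏ s' ∈ S.erase s, (X 0 - C s'), ?_, ?_, ?_⟩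
    · refine (totalDegree_mul _ _).trans ?_
      rw [hT]
      refine add_le_add ((totalDegree_finsetProd _ _).trans ?_)
        ((totalDegree_finsetProd _ _).trans ?_)
      · refine (Finset.sum_le_card_nsmul _ _ 1 fun l' _ => hq1 l').trans ?_
        rw [smul_eq_mul, mul_one]
        exact (Finset.card_le_card (Finset.erase_subset _ _)).trans hM.le
      · refine (Finset.sum_le_card_nsmul _ _ 1 fun s' _ =>
          (totalDegree_sub_C_le _ _).trans (totalDegree_X _).le).trans ?_
        rw [smul_eq_mul, mul_one]
        exact (Finset.card_le_card (Finset.erase_subset _ _)).trans hSc.le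
    · rw [map_mul, map_prod, map_prod]
      refine mul_ne_zero (Finset.prod_ne_zero_iff.mpr fun l' hl' => ?_)
        (Finset.prod_ne_zero_iff.mpr fun s' hs' => ?_)
      · exact (hq2 l' (Finset.mem_of_mem_erase hl') (Finset.ne_of_mem_erase hl')).1
      · simpa [linePoint, sub_eq_zero] using (Finset.ne_of_mem_erase hs').symm
    · intro y hy hne
      obtain ⟨⟨l', s'⟩, hls', rfl⟩ := Finset.mem_image.mp hy
      obtain ⟨hl', hs'⟩ := Finset.mem_product.mp hls'
      simp only at hl' hs' hne ⊢
      rw [map_mul, map_prod, map_prod]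
      by_cases hss : s' = s
      · subst hss
        have : l' ≠ l := fun h => hne (by rw [h])
        rw [Finset.prod_eq_zero (Finset.mem_erase.mpr ⟨this, hl'⟩) (hq2 l' hl' this).2, zero_mul]
      · rw [Finset.prod_eq_zero (s := S.erase s) (Finset.mem_erase.mpr ⟨hss, hs'⟩)
          (by simp [linePoint]), mul_zero])
  have d1 := six_mul_finrank_restrictTotalDegree K (T + b)
  have d2 := six_mul_finrank_restrictTotalDegree K (T + a)
  have d3 := six_mul_finrank_restrictTotalDegree K (T + a + b)
  have d4 := six_mul_finrank_restrictTotalDegree K T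
  have hineq : 6 * (m * N) + (T + b + 1) * (T + b + 2) * (T + b + 3) +
      (T + a + 1) * (T + a + 2) * (T + a + 3) ≤
      (T + a + b + 1) * (T + a + b + 2) * (T + a + b + 3) + (T + 1) * (T + 2) * (T + 3) := by
    rw [← d1, ← d2, ← d3, ← d4]
    omega
  have hid : (T + a + b + 1) * (T + a + b + 2) * (T + a + b + 3) + (T + 1) * (T + 2) * (T + 3) =
      (T + b + 1) * (T + b + 2) * (T + b + 3) + (T + a + 1) * (T + a + 2) * (T + a + 3) +
      3 * (a * b * (2 * T + 4 + a + b)) := by ring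
  have hdiff : 2 * (m * N) ≤ a * b * (2 * T + 4 + a + b) := by omega
  have hTe : T = 2 * m * m + m + m := by omega
  rw [hTe, hN, hm] at hdiff
  generalize a * b = k at hdiff
  nlinarith
end Polynomials
section Degree
open MvPolynomial

variable {K : Type*} [Field K]

/-- Restriction of a polynomial to the line `l`, parametrised by the first coordinate. -/
noncomputable def restr (l : K × K × K) : MvPolynomial (Fin 3) K →ₐ[K] Polynomial K :=
  aeval ![Polynomial.X, Polynomial.C l.2.1 + Polynomial.C l.1 * Polynomial.X,
    Polynomial.C l.2.2 + Polynomial.C (l.1 ^ 2) * Polynomial.X]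

theorem eval_restr (l : K × K × K) (s : K) (f : MvPolynomial (Fin 3) K) :
    (restr l f).eval s = eval (linePoint l s) f := by
  have : ((Polynomial.evalRingHom s).comp (restr l).toRingHom) = eval (linePoint l s) := by
    ext i
    · simp [restr]
    · fin_cases i <;> simp [restr, linePoint]
  exact congrArg (fun φ => φ f) this

theorem natDegree_restr_le (l : K × K × K) (f : MvPolynomial (Fin 3) K) :
    (restr l f).natDegree ≤ f.totalDegree := by
  have := aeval_natDegree_le f le_rfl (n := 1)
    ![Polynomial.X, Polynomial.C l.2.1 + Polynomial.C l.1 * Polynomial.X,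
      Polynomial.C l.2.2 + Polynomial.C (l.1 ^ 2) * Polynomial.X] (by
    intro i
    fin_cases i
    · simp
    · simp only [Fin.mk_one, Matrix.cons_val_one, Matrix.cons_val_zero]
      compute_degree
    · simp only [Fin.reduceFinMk, Matrix.cons_val]
      compute_degree)
  simpa [restr] using this

theorem restr_eq_zero_of_card {l : K × K × K} {f : MvPolynomial (Fin 3) K} (Z : Finset K)
    (hZ : ∀ s ∈ Z, eval (linePoint l s) f = 0) (hcard : f.totalDegree < Z.card) :
    restr l f = 0 :=
  Polynomial.eq_zero_of_natDegree_lt_card_of_eval_eq_zero' _ Z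
    (fun s hs => (eval_restr l s f).trans (hZ s hs)) ((natDegree_restr_le l f).trans_lt hcard)

open Classical in
/-- The parameters of the points in which the line `l` meets other lines of `L`. -/
noncomputable def crossings (L : Finset (K × K × K)) (l : K × K × K) : Finset K :=
  (L.image fun l' => (l.2.1 - l'.2.1) / (l'.1 - l.1)).filter fun s =>
    ∃ l' ∈ L, l' ≠ l ∧ linePoint l' s = linePoint l s

theorem linePoint_eq_iff {l l' : K × K × K} (h : l' ≠ l) {s : K} :
    linePoint l' s = linePoint l s ↔ l'.1 ≠ l.1 ∧
      l.2.2 - l'.2.2 = (l.1 + l'.1) * (l.2.1 - l'.2.1) ∧ s = (l.2.1 - l'.2.1) / (l'.1 - l.1) := by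
  have key : linePoint l' s = linePoint l s ↔
      l'.2.1 + l'.1 * s = l.2.1 + l.1 * s ∧ l'.2.2 + l'.1 ^ 2 * s = l.2.2 + l.1 ^ 2 * s := by
    constructor
    · intro h
      exact ⟨by simpa [linePoint] using congrFun h 1, by simpa [linePoint] using congrFun h 2⟩
    · rintro ⟨h1, h2⟩
      simp [linePoint, h1, h2]
  rw [key]
  constructor
  · rintro ⟨h1, h2⟩
    have hne : l'.1 ≠ l.1 := by
      intro h0
      rw [h0] at h1 h2
      exact h (Prod.ext h0 (Prod.ext (add_right_cancel h1) (add_right_cancel h2)))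
    refine ⟨hne, by linear_combination (l.1 + l'.1) * h1 - h2, ?_⟩
    rw [eq_div_iff (sub_ne_zero.mpr hne)]
    linear_combination h1
  · rintro ⟨hne, h1, h2⟩
    rw [eq_div_iff (sub_ne_zero.mpr hne)] at h2
    exact ⟨by linear_combination h2, by linear_combination (l.1 + l'.1) * h2 - h1⟩

theorem mem_crossings {L : Finset (K × K × K)} {l : K × K × K} {s : K} :
    s ∈ crossings L l ↔ ∃ l' ∈ L, l' ≠ l ∧ linePoint l' s = linePoint l s := by
  classical
  simp only [crossings, Finset.mem_filter, Finset.mem_image, and_iff_right_iff_imp]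
  rintro ⟨l', hl', hne, h⟩
  exact ⟨l', hl', ((linePoint_eq_iff hne).mp h).2.2.symm⟩

theorem crossings_mono {L M : Finset (K × K × K)} (h : L ⊆ M) (l : K × K × K) :
    crossings L l ⊆ crossings M l := by
  intro s hs
  obtain ⟨l', hl', h'⟩ := mem_crossings.mp hs
  exact mem_crossings.mpr ⟨l', h hl', h'⟩

theorem exists_vanishing_of_card_lt (d : ℕ) (P : Finset (Fin 3 → K))
    (hP : 6 * P.card < (d + 1) * (d + 2) * (d + 3)) :
    ∃ f : MvPolynomial (Fin 3) K, f ≠ 0 ∧ f.totalDegree ≤ d ∧ ∀ x ∈ P, eval x f = 0 := by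
  classical
  let ev : MvPolynomial (Fin 3) K →ₗ[K] (P → K) := LinearMap.pi fun x => (aeval x.1).toLinearMap
  let evT := ev.domRestrict (restrictTotalDegree (Fin 3) K d)
  have hker : LinearMap.ker evT ≠ ⊥ := by
    apply LinearMap.ker_ne_bot_of_finrank_lt
    rw [Module.finrank_fintype_fun_eq_card, Fintype.card_coe]
    have := six_mul_finrank_restrictTotalDegree K d
    omega
  obtain ⟨f, hf, hf0⟩ := (Submodule.ne_bot_iff _).mp hker
  refine ⟨f.1, fun h => hf0 (Subtype.ext h), (mem_restrictTotalDegree _ _ _).mp f.2, ?_⟩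
  intro x hx
  have := congrFun (LinearMap.mem_ker.mp hf) ⟨x, hx⟩
  simpa [evT, ev, aeval_eq_eval] using this

/-- A random-sampling type argument: a set of lines with many crossings on each of them has a
subset `S` such that all but few of the lines meet `S` in `m` points, up to a small total
deficit. -/
theorem exists_sample (L : Finset (K × K × K)) (m Q β : ℕ) (hmQ : m ≤ Q)
    (hQ : ∀ l ∈ L, Q ≤ (crossings L l).card) :
    ∃ S ⊆ L, β * S.card ≤ L.card * m ∧
      (∑ l ∈ L, (m - (crossings S l).card)) * (Q - m) ≤ m * (β * L.card) := by
  classical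
  obtain ⟨S, hS, hmin⟩ := Finset.exists_min_image L.powerset
    (fun S => β * S.card + ∑ l ∈ L, (m - (crossings S l).card)) ⟨∅, by simp⟩
  rw [Finset.mem_powerset] at hS
  refine ⟨S, hS, ?_, ?_⟩
  · have h0 := hmin ∅ (by simp)
    have : ∑ l ∈ L, (m - (crossings (∅ : Finset (K × K × K)) l).card) ≤ L.card * m := by
      rw [← smul_eq_mul]
      exact Finset.sum_le_card_nsmul _ _ _ fun _ _ => Nat.sub_le _ _
    simp only [Finset.card_empty, mul_zero, zero_add] at h0
    omega
  -- the gain of `l` when `l'` is added to the sample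
  set gain : K × K × K → K × K × K → ℕ := fun l' l =>
    (m - (crossings S l).card) - (m - (crossings (insert l' S) l).card) with hgain
  have hmono : ∀ l' l, m - (crossings (insert l' S) l).card ≤ m - (crossings S l).card :=
    fun l' l => Nat.sub_le_sub_left
      (Finset.card_le_card (crossings_mono (Finset.subset_insert _ _) l)) m
  have hgainle : ∀ l' ∈ L, ∑ l ∈ L, gain l' l ≤ β := by
    intro l' hl'
    have h1 := hmin (insert l' S) (Finset.mem_powerset.mpr (Finset.insert_subset hl' hS))
    have h2 : (insert l' S).card ≤ S.card + 1 := Finset.card_insert_le _ _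
    have h3 : ∑ l ∈ L, gain l' l + ∑ l ∈ L, (m - (crossings (insert l' S) l).card) =
        ∑ l ∈ L, (m - (crossings S l).card) := by
      rw [← Finset.sum_add_distrib]
      exact Finset.sum_congr rfl fun l _ => Nat.sub_add_cancel (hmono l' l)
    have h4 : β * (insert l' S).card ≤ β * S.card + β := by
      calc β * (insert l' S).card ≤ β * (S.card + 1) := Nat.mul_le_mul_left _ h2
        _ = _ := by ring
    omega
  have hmany : ∀ l ∈ L, (m - (crossings S l).card) * (Q - m) ≤ m * ∑ l' ∈ L, gain l' l := by
    intro l hl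
    by_cases hdef : m ≤ (crossings S l).card
    · simp [Nat.sub_eq_zero_of_le hdef]
    push Not at hdef
    refine Nat.mul_le_mul (Nat.sub_le _ _) ?_
    have hsub : ∀ s ∈ crossings L l \ crossings S l, ∃ l' ∈ L, l' ≠ l ∧
        linePoint l' s = linePoint l s := fun s hs => mem_crossings.mp (Finset.mem_sdiff.mp hs).1
    choose! g hg using hsub
    have hginj : Set.InjOn g (crossings L l \ crossings S l : Finset K) := by
      intro s hs t ht hst
      rw [((linePoint_eq_iff (hg s hs).2.1).mp (hg s hs).2.2).2.2,
        ((linePoint_eq_iff (hg t ht).2.1).mp (hg t ht).2.2).2.2, hst]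
    calc Q - m ≤ (crossings L l \ crossings S l).card := by
          have := Finset.le_card_sdiff (crossings S l) (crossings L l)
          have := hQ l hl
          omega
      _ = ((crossings L l \ crossings S l).image g).card :=
          (Finset.card_image_of_injOn hginj).symm
      _ = ∑ l' ∈ (crossings L l \ crossings S l).image g, 1 := by simp
      _ ≤ ∑ l' ∈ (crossings L l \ crossings S l).image g, gain l' l := by
          refine Finset.sum_le_sum fun l' hl' => ?_
          obtain ⟨s, hs, rfl⟩ := Finset.mem_image.mp hl'
          have hlt : (crossings S l).card < (crossings (insert (g s) S) l).card := by
            refine Finset.card_lt_card ⟨crossings_mono (Finset.subset_insert _ _) l, fun h => ?_⟩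
            exact (Finset.mem_sdiff.mp hs).2 (h (mem_crossings.mpr
              ⟨g s, Finset.mem_insert_self _ _, (hg s hs).2⟩))
          simp only [hgain]
          omega
      _ ≤ ∑ l' ∈ L, gain l' l := by
          refine Finset.sum_le_sum_of_subset fun l' hl' => ?_
          obtain ⟨s, hs, rfl⟩ := Finset.mem_image.mp hl'
          exact (hg s hs).1
  calc (∑ l ∈ L, (m - (crossings S l).card)) * (Q - m)
      = ∑ l ∈ L, (m - (crossings S l).card) * (Q - m) := Finset.sum_mul _ _ _
    _ ≤ ∑ l ∈ L, m * ∑ l' ∈ L, gain l' l := Finset.sum_le_sum hmany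
    _ = m * ∑ l' ∈ L, ∑ l ∈ L, gain l' l := by rw [← Finset.mul_sum, Finset.sum_comm]
    _ ≤ m * (L.card * β) := by
        refine Nat.mul_le_mul_left _ ?_
        rw [← smul_eq_mul]
        exact Finset.sum_le_card_nsmul _ _ _ hgainle
    _ = m * (β * L.card) := by ring

/-- Degree reduction: a polynomial of unexpectedly low degree vanishing on all the lines. -/
theorem exists_restr_eq_zero [Infinite K] (L : Finset (K × K × K)) (d Q : ℕ)
    (hL : L.card ≤ 64 * (d + 1) ^ 2) (hd : d + 1 ≤ L.card) (hQd : 3000001 * (d + 1) ≤ Q)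
    (hQ : ∀ l ∈ L, Q ≤ (crossings L l).card) :
    ∃ f : MvPolynomial (Fin 3) K, f ≠ 0 ∧ f.totalDegree ≤ d ∧ ∀ l ∈ L, restr l f = 0 := by
  classical
  set m := d + 1 with hm
  set N := L.card with hN
  set β := 24 * N / m + 1 with hβ
  have hβ1 : 24 * N ≤ m * β := (Nat.lt_mul_div_succ (24 * N) (Nat.succ_pos d)).le
  have hβ2 : m * β ≤ 25 * N := by
    have := Nat.mul_div_le (24 * N) m
    rw [hβ, mul_add]
    omega
  obtain ⟨S, hSL, hS1, hS2⟩ := exists_sample L m Q β (by omega) hQ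
  set Φ := ∑ l ∈ L, (m - (crossings S l).card) with hΦ
  have hex : ∀ l, ∃ D : Finset K, D.card = m - (crossings S l).card ∧
      Disjoint (crossings S l) D := by
    intro l
    obtain ⟨D, hD, hDc⟩ := ((crossings S l).finite_toSet.infinite_compl).exists_subset_card_eq
      (m - (crossings S l).card)
    exact ⟨D, hDc, Finset.disjoint_right.mpr fun s hs => hD hs⟩
  choose D hDc hDd using hex
  obtain ⟨Z, hZ⟩ := Infinite.exists_subset_card_eq K m
  set P := (S ×ˢ Z).image (fun q => linePoint q.1 q.2) ∪
    L.biUnion (fun l => (D l).image (linePoint l)) with hP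
  have hPc : P.card ≤ S.card * m + Φ := by
    refine (Finset.card_union_le _ _).trans (add_le_add ?_ ?_)
    · exact Finset.card_image_le.trans (by rw [Finset.card_product, hZ])
    · exact Finset.card_biUnion_le.trans
        (Finset.sum_le_sum fun l _ => Finset.card_image_le.trans (hDc l).le)
  have hSm : 24 * (S.card * m) ≤ m ^ 3 := by
    have h1 : N * (24 * (S.card * m)) ≤ N * m ^ 3 := by
      calc N * (24 * (S.card * m)) = (24 * N) * (S.card * m) := by ring
        _ ≤ (m * β) * (S.card * m) := Nat.mul_le_mul_right _ hβ1
        _ = (β * S.card) * m ^ 2 := by ring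
        _ ≤ (N * m) * m ^ 2 := Nat.mul_le_mul_right _ hS1
        _ = N * m ^ 3 := by ring
    exact Nat.le_of_mul_le_mul_left h1 (by omega)
  have hΦm : 24 * Φ ≤ m ^ 3 := by
    have h1 : Φ * (3000000 * m) ≤ 102400 * m ^ 4 := by
      calc Φ * (3000000 * m) ≤ Φ * (Q - m) := Nat.mul_le_mul_left _ (by omega)
        _ ≤ m * (β * N) := hS2
        _ = (m * β) * N := by ring
        _ ≤ (25 * N) * N := Nat.mul_le_mul_right _ hβ2
        _ ≤ (25 * (64 * m ^ 2)) * (64 * m ^ 2) := by gcongr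
        _ = 102400 * m ^ 4 := by ring
    have h2 : m * (3000000 * Φ) ≤ m * (102400 * m ^ 3) := by
      calc _ = Φ * (3000000 * m) := by ring
        _ ≤ _ := h1
        _ = _ := by ring
    have h3 := Nat.le_of_mul_le_mul_left h2 (Nat.succ_pos d)
    omega
  obtain ⟨f, hf0, hfd, hfP⟩ := exists_vanishing_of_card_lt d P (by
    have : m ^ 3 < (d + 1) * (d + 2) * (d + 3) := by rw [hm]; nlinarith
    have : 0 < m ^ 3 := by positivity
    omega)
  have hSz : ∀ l ∈ S, restr l f = 0 := fun l hl =>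
    restr_eq_zero_of_card Z (fun s hs => hfP _ (Finset.mem_union_left _
      (Finset.mem_image.mpr ⟨(l, s), Finset.mem_product.mpr ⟨hl, hs⟩, rfl⟩))) (by omega)
  refine ⟨f, hf0, hfd, fun l hl => restr_eq_zero_of_card (crossings S l ∪ D l) ?_ ?_⟩
  · intro s hs
    rcases Finset.mem_union.mp hs with hs | hs
    · obtain ⟨l', hl', -, h⟩ := mem_crossings.mp hs
      rw [← h, ← eval_restr, hSz l' hl', Polynomial.eval_zero]
    · exact hfP _ (Finset.mem_union_right _ (Finset.mem_biUnion.mpr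
        ⟨l, hl, Finset.mem_image_of_mem _ hs⟩))
  · rw [Finset.card_union_of_disjoint (hDd l), hDc]
    omega
end Degree
section Univariate
open Polynomial

variable {K : Type*} [Field K]

/-- If the logarithmic derivatives of two polynomials of small degree agree, the polynomials are
proportional. -/
theorem eq_C_mul_of_derivative_mul_eq {n : ℕ} (hn : ∀ j : ℕ, 0 < j → j ≤ n → (j : K) ≠ 0)
    {u v : K[X]} (hv : v ≠ 0) (hun : u.natDegree ≤ n) (hvn : v.natDegree ≤ n)
    (h : derivative u * v = u * derivative v) : ∃ c, u = C c * v := by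
  have key : ∀ w : K[X], w ≠ 0 → w.natDegree ≤ n → derivative w * v = w * derivative v →
      w.natDegree = v.natDegree := by
    intro w hw hwn hwv
    have hcast : (w.natDegree : K) = (v.natDegree : K) := by
      by_cases h0 : w.natDegree + v.natDegree = 0
      · rw [show w.natDegree = 0 by omega, show v.natDegree = 0 by omega]
      have hd : ∀ a b : K[X], (derivative a * b).coeff (a.natDegree + b.natDegree - 1) =
          a.natDegree * a.leadingCoeff * b.leadingCoeff := by
        intro a b
        by_cases ha : a.natDegree = 0
        · rw [natDegree_eq_zero.mp ha |>.choose_spec.symm]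
          simp
        have : a.natDegree + b.natDegree - 1 = (a.natDegree - 1) + b.natDegree := by omega
        rw [this, coeff_mul_add_eq_of_natDegree_le (natDegree_derivative_le a) le_rfl, coeff_derivative,
          Nat.sub_add_cancel (by omega), leadingCoeff, leadingCoeff]
        have h1 : ((a.natDegree - 1 : ℕ) : K) + 1 = (a.natDegree : K) := by
          rw [← Nat.cast_add_one, Nat.sub_add_cancel (by omega)]
        rw [h1]
        ring
      have h1 := hd w v
      have h2 := hd v w
      rw [hwv, mul_comm, add_comm, h2] at h1
      have h3 : w.leadingCoeff * v.leadingCoeff ≠ 0 :=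
        mul_ne_zero (leadingCoeff_ne_zero.mpr hw) (leadingCoeff_ne_zero.mpr hv)
      apply mul_right_cancel₀ h3
      linear_combination -h1
    by_contra hne
    rcases lt_or_gt_of_ne hne with hlt | hlt
    · refine hn (v.natDegree - w.natDegree) (by omega) (by omega) ?_
      rw [Nat.cast_sub hlt.le, hcast, sub_self]
    · refine hn (w.natDegree - v.natDegree) (by omega) (by omega) ?_
      rw [Nat.cast_sub hlt.le, hcast, sub_self]
  by_cases hu : u = 0
  · exact ⟨0, by simp [hu]⟩
  refine ⟨u.leadingCoeff / v.leadingCoeff, ?_⟩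
  set c := u.leadingCoeff / v.leadingCoeff with hc
  have hlv : v.leadingCoeff ≠ 0 := leadingCoeff_ne_zero.mpr hv
  have hc0 : c ≠ 0 := div_ne_zero (leadingCoeff_ne_zero.mpr hu) hlv
  by_contra hne
  have hdeg := key u hu hun h
  have hlt : (u - C c * v).degree < u.degree := by
    apply degree_sub_lt_left _ hu
    · rw [leadingCoeff_mul, leadingCoeff_C, hc, div_mul_cancel₀ _ hlv]
    · rw [degree_C_mul hc0, degree_eq_natDegree hu, degree_eq_natDegree hv, hdeg]
  have hlt' := natDegree_lt_natDegree (sub_ne_zero.mpr hne) hlt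
  have := key (u - C c * v) (sub_ne_zero.mpr hne) (by omega) (by
    rw [derivative_sub, derivative_C_mul]
    linear_combination h)
  omega

theorem exists_linear_ratio {d : ℕ} (hd : ∀ j : ℕ, 0 < j → j ≤ 2 * d → (j : K) ≠ 0)
    {p q B : K[X]} (hp : p ≠ 0) (hq : q ≠ 0) (hpd : p.natDegree < d)
    (hqd : q.natDegree < d) (h1 : q ^ 3 * (2 * derivative p) = p * B)
    (h2 : q * (q ^ 3 * derivative (derivative p) - derivative p * B) =
      p * (q ^ 3 * derivative (derivative q) - derivative q * B)) :
    ∃ c γ : K, q = (C γ - C c * X) * p := by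
  set W := q * derivative p - p * derivative q with hW
  have hW' : derivative W = q * derivative (derivative p) - p * derivative (derivative q) := by
    simp only [hW, derivative_sub, derivative_mul]
    ring
  have hW1 : q ^ 3 * (derivative W * p) = q ^ 3 * (2 * derivative p * W) := by
    rw [hW']
    linear_combination p * h2 - W * h1
  have hW2 := mul_left_cancel₀ (pow_ne_zero 3 hq) hW1
  have hpd' := natDegree_derivative_le p
  have hqd' := natDegree_derivative_le q
  have hWd : W.natDegree ≤ 2 * d := by
    refine (natDegree_sub_le _ _).trans (max_le ?_ ?_)
    · exact natDegree_mul_le.trans (by omega)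
    · exact natDegree_mul_le.trans (by omega)
  obtain ⟨c, hc⟩ := eq_C_mul_of_derivative_mul_eq hd (pow_ne_zero 2 hp) hWd
    (natDegree_pow_le.trans (by omega)) (u := W) (by
      rw [derivative_sq, C_ofNat]
      linear_combination p * hW2)
  have hXp : (C c * X * p).natDegree ≤ d := by
    refine natDegree_mul_le.trans ?_
    have := (natDegree_C_mul_le c X).trans natDegree_X_le
    omega
  obtain ⟨γ, hγ⟩ := eq_C_mul_of_derivative_mul_eq hd hp (u := q + C c * X * p)
    ((natDegree_add_le _ _).trans (by omega)) (by omega) (by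
      simp only [derivative_add, derivative_mul, derivative_C, derivative_X]
      linear_combination hW - hc)
  exact ⟨c, γ, by linear_combination hγ⟩
end Univariate

section Derivations
open MvPolynomial

variable {K : Type*} [Field K]

theorem totalDegree_pderiv_lt {i : Fin 3} {f : MvPolynomial (Fin 3) K} (h : pderiv i f ≠ 0) :
    (pderiv i f).totalDegree < f.totalDegree := by
  have key : ∀ m ∈ (pderiv i f).support, (m.sum fun _ e => e) + 1 ≤ f.totalDegree := by
    intro m hm
    rw [mem_support_iff, coeff_pderiv] at hm
    have hm' : m + Finsupp.single i 1 ∈ f.support := by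
      rw [mem_support_iff]
      intro h0
      simp [h0] at hm
    have := le_totalDegree hm'
    rwa [Finsupp.sum_add_index' (by simp) (by simp), Finsupp.sum_single_index (by simp)] at this
  obtain ⟨m, hm⟩ := Finset.nonempty_iff_ne_empty.mpr (support_eq_empty.not.mpr h)
  have := key m hm
  refine (Finset.sup_lt_iff (by simp only [Nat.bot_eq_zero]; omega)).mpr fun m hm => ?_
  have := key m hm
  omega

theorem exists_pderiv_ne_zero {f : MvPolynomial (Fin 3) K} (hf : f.totalDegree ≠ 0)
    (hchar : ∀ j : ℕ, 0 < j → j ≤ f.totalDegree → (j : K) ≠ 0) : ∃ i, pderiv i f ≠ 0 := by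
  by_contra! h
  refine hf (Nat.le_zero.mp (Finset.sup_le fun m hm => (Finset.sum_eq_zero fun i _ => ?_).le))
  by_contra hi
  change m i ≠ 0 at hi
  have hle : Finsupp.single i 1 ≤ m := by
    rw [Finsupp.single_le_iff]
    omega
  have hc := coeff_pderiv (i := i) f (m - Finsupp.single i 1)
  rw [h i, coeff_zero, tsub_add_cancel_of_le hle] at hc
  have hmi : m i ≤ f.totalDegree := by
    refine le_trans ?_ (le_totalDegree hm)
    exact Finset.single_le_sum (f := fun i => m i) (fun _ _ => Nat.zero_le _)
      (Finsupp.mem_support_iff.mpr hi)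
  have h1 := hchar (m i) (by omega) hmi
  have h2 := mem_support_iff.mp hm
  have h3 : (((m - Finsupp.single i 1 : Fin 3 →₀ ℕ) i : ℕ) : K) + 1 = (m i : K) := by
    rw [← Nat.cast_add_one]
    congr 1
    simp
    omega
  rw [h3] at hc
  exact mul_ne_zero h2 h1 hc.symm

/-- The derivative in the direction `(1, σ, σ²)`. -/
noncomputable def dirX (σ : K) : Derivation K (MvPolynomial (Fin 3) K) (MvPolynomial (Fin 3) K) :=
  pderiv 0 + σ • pderiv 1 + σ ^ 2 • pderiv 2

/-- The derivative in the direction `(0, 1, 2σ)`. -/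
noncomputable def dirY (σ : K) : Derivation K (MvPolynomial (Fin 3) K) (MvPolynomial (Fin 3) K) :=
  pderiv 1 + (2 * σ) • pderiv 2

theorem dirX_dirY (σ : K) (f : MvPolynomial (Fin 3) K) :
    dirX σ (dirY σ f) = dirY σ (dirX σ f) := by
  have : ⁅dirX σ, dirY σ⁆ = 0 := by
    refine derivation_ext fun i => ?_
    fin_cases i <;> simp [Derivation.commutator_apply, dirX, dirY, pderiv_X]
  have h := congrArg (fun D => D f) this
  simpa [Derivation.commutator_apply, sub_eq_zero] using h

theorem dirX_pderiv_two (σ : K) (f : MvPolynomial (Fin 3) K) :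
    dirX σ (pderiv 2 f) = pderiv 2 (dirX σ f) := by
  have : ⁅dirX σ, pderiv (R := K) (2 : Fin 3)⁆ = 0 := by
    refine derivation_ext fun i => ?_
    fin_cases i <;> simp [Derivation.commutator_apply, dirX, pderiv_X]
  have h := congrArg (fun D => D f) this
  simpa [Derivation.commutator_apply, sub_eq_zero] using h

theorem dirX_eq (σ τ : K) (f : MvPolynomial (Fin 3) K) :
    dirX σ f = dirX τ f + (σ - τ) • dirY τ f + (σ - τ) ^ 2 • pderiv 2 f := by
  simp only [dirX, dirY, Derivation.add_apply, Derivation.smul_apply]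
  module

theorem totalDegree_pderiv_le (i : Fin 3) (f : MvPolynomial (Fin 3) K) :
    (pderiv i f).totalDegree ≤ f.totalDegree - 1 := by
  by_cases h : pderiv i f = 0
  · simp [h]
  · have := totalDegree_pderiv_lt h
    omega

theorem totalDegree_add_le_of_le {f g : MvPolynomial (Fin 3) K} {n : ℕ} (hf : f.totalDegree ≤ n)
    (hg : g.totalDegree ≤ n) : (f + g).totalDegree ≤ n :=
  (totalDegree_add _ _).trans (max_le hf hg)

theorem totalDegree_dirX_le (σ : K) (f : MvPolynomial (Fin 3) K) :
    (dirX σ f).totalDegree ≤ f.totalDegree - 1 := by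
  simp only [dirX, Derivation.add_apply, Derivation.smul_apply]
  refine totalDegree_add_le_of_le (totalDegree_add_le_of_le ?_ ?_) ?_
  · exact totalDegree_pderiv_le _ _
  · exact (totalDegree_smul_le _ _).trans (totalDegree_pderiv_le _ _)
  · exact (totalDegree_smul_le _ _).trans (totalDegree_pderiv_le _ _)

theorem totalDegree_dirY_le (σ : K) (f : MvPolynomial (Fin 3) K) :
    (dirY σ f).totalDegree ≤ f.totalDegree - 1 := by
  simp only [dirY, Derivation.add_apply, Derivation.smul_apply]
  refine totalDegree_add_le_of_le ?_ ?_
  · exact totalDegree_pderiv_le _ _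
  · exact (totalDegree_smul_le _ _).trans (totalDegree_pderiv_le _ _)

theorem derivative_restr (l : K × K × K) (f : MvPolynomial (Fin 3) K) :
    Polynomial.derivative (restr l f) = restr l (dirX l.1 f) := by
  induction f using MvPolynomial.induction_on with
  | C a => simp [restr, dirX, ← MvPolynomial.algebraMap_eq]
  | add f g hf hg => simp only [map_add, hf, hg]
  | mul_X f i hf =>
    rw [map_mul, Polynomial.derivative_mul, hf, Derivation.leibniz, smul_eq_mul, smul_eq_mul,
      map_add, map_mul, map_mul]
    have : Polynomial.derivative (restr l (X i)) = restr l (dirX l.1 (X i)) := by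
      fin_cases i <;> simp [restr, dirX, pderiv_X, Polynomial.smul_eq_C_mul,
        Polynomial.derivative_pow]
    rw [this]
    ring
end Derivations
section Osculation
open MvPolynomial

variable {K : Type*} [Field K]

theorem totalDegree_mul_le_of_le {f g : MvPolynomial (Fin 3) K} {a b : ℕ}
    (hf : f.totalDegree ≤ a) (hg : g.totalDegree ≤ b) : (f * g).totalDegree ≤ a + b :=
  (totalDegree_mul _ _).trans (add_le_add hf hg)

theorem totalDegree_sub_le_of_le {f g : MvPolynomial (Fin 3) K} {n : ℕ} (hf : f.totalDegree ≤ n)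
    (hg : g.totalDegree ≤ n) : (f - g).totalDegree ≤ n :=
  (totalDegree_sub _ _).trans (max_le hf hg)

/-- Second derivative of `f` in two directions `(0, 1, 2σ)` and `(1, σ, σ²)`. -/
noncomputable def secondOne (σ : K) (f : MvPolynomial (Fin 3) K) : MvPolynomial (Fin 3) K :=
  dirX σ (dirY σ f) + dirY σ (dirX σ f)

/-- The coefficient of `τ²` in the second derivative of `f` along `(1, σ + τ, (σ + τ)²)`. -/
noncomputable def secondTwo (σ : K) (f : MvPolynomial (Fin 3) K) : MvPolynomial (Fin 3) K :=
  dirX σ (pderiv 2 f) + dirY σ (dirY σ f) + pderiv 2 (dirX σ f)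

/-- The coefficient of `τ³` in the second derivative of `f` along `(1, σ + τ, (σ + τ)²)`. -/
noncomputable def secondThree (σ : K) (f : MvPolynomial (Fin 3) K) : MvPolynomial (Fin 3) K :=
  dirY σ (pderiv 2 f) + pderiv 2 (dirY σ f)

/-- The cofactor of the first derivative in `osculant`. -/
noncomputable def cofactor (σ : K) (f : MvPolynomial (Fin 3) K) : MvPolynomial (Fin 3) K :=
  pderiv 2 f ^ 2 * secondTwo σ f - dirY σ f * pderiv 2 f * secondThree σ f +
    (dirY σ f ^ 2 - dirX σ f * pderiv 2 f) * pderiv 2 (pderiv 2 f)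

/-- A polynomial vanishing wherever two different directions `(1, σ', σ'²)` are both tangent to
second order to the zero set of `f`. -/
noncomputable def osculant (σ : K) (f : MvPolynomial (Fin 3) K) : MvPolynomial (Fin 3) K :=
  pderiv 2 f ^ 3 * dirX σ (dirX σ f) - dirX σ f * cofactor σ f

section Degree
variable (σ : K) (f : MvPolynomial (Fin 3) K)

theorem totalDegree_dirX_le' : (dirX σ f).totalDegree ≤ f.totalDegree :=
  (totalDegree_dirX_le σ f).trans (Nat.sub_le _ _)

theorem totalDegree_dirY_le' : (dirY σ f).totalDegree ≤ f.totalDegree :=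
  (totalDegree_dirY_le σ f).trans (Nat.sub_le _ _)

theorem totalDegree_pderiv_le' (i : Fin 3) : (pderiv i f).totalDegree ≤ f.totalDegree :=
  (totalDegree_pderiv_le i f).trans (Nat.sub_le _ _)

theorem totalDegree_secondOne_le : (secondOne σ f).totalDegree ≤ f.totalDegree :=
  totalDegree_add_le_of_le
    ((totalDegree_dirX_le' _ _).trans (totalDegree_dirY_le' _ _))
    ((totalDegree_dirY_le' _ _).trans (totalDegree_dirX_le' _ _))

theorem totalDegree_secondTwo_le : (secondTwo σ f).totalDegree ≤ f.totalDegree :=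
  totalDegree_add_le_of_le (totalDegree_add_le_of_le
    ((totalDegree_dirX_le' _ _).trans (totalDegree_pderiv_le' _ _))
    ((totalDegree_dirY_le' _ _).trans (totalDegree_dirY_le' _ _)))
    ((totalDegree_pderiv_le' _ _).trans (totalDegree_dirX_le' _ _))

theorem totalDegree_secondThree_le : (secondThree σ f).totalDegree ≤ f.totalDegree :=
  totalDegree_add_le_of_le
    ((totalDegree_dirY_le' _ _).trans (totalDegree_pderiv_le' _ _))
    ((totalDegree_pderiv_le' _ _).trans (totalDegree_dirY_le' _ _))

theorem totalDegree_cofactor_le : (cofactor σ f).totalDegree ≤ 3 * f.totalDegree := by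
  have hX := totalDegree_dirX_le' σ f
  have hY := totalDegree_dirY_le' σ f
  have hZ := totalDegree_pderiv_le' f 2
  have hZZ := (totalDegree_pderiv_le' (pderiv 2 f) 2).trans hZ
  have h2 := totalDegree_secondTwo_le σ f
  have h3 := totalDegree_secondThree_le σ f
  have e : 3 * f.totalDegree = f.totalDegree + f.totalDegree + f.totalDegree := by ring
  rw [cofactor, e, sq, sq]
  exact totalDegree_add_le_of_le (totalDegree_sub_le_of_le
    (totalDegree_mul_le_of_le (totalDegree_mul_le_of_le hZ hZ) h2)
    (totalDegree_mul_le_of_le (totalDegree_mul_le_of_le hY hZ) h3))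
    (totalDegree_mul_le_of_le (totalDegree_sub_le_of_le (totalDegree_mul_le_of_le hY hY)
      (totalDegree_mul_le_of_le hX hZ)) hZZ)

theorem totalDegree_osculant_le : (osculant σ f).totalDegree ≤ 4 * f.totalDegree := by
  have hX := totalDegree_dirX_le' σ f
  have hXX := (totalDegree_dirX_le' σ (dirX σ f)).trans hX
  have hZ := totalDegree_pderiv_le' f 2
  have hc := totalDegree_cofactor_le σ f
  have h3 : (pderiv 2 f ^ 3).totalDegree ≤ 3 * f.totalDegree :=
    (totalDegree_pow _ _).trans (Nat.mul_le_mul_left _ hZ)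
  refine totalDegree_sub_le_of_le ((totalDegree_mul_le_of_le h3 hXX).trans ?_)
    ((totalDegree_mul_le_of_le hX hc).trans ?_) <;> omega
end Degree

theorem dirX_dirX_eq (σ τ : K) (f : MvPolynomial (Fin 3) K) :
    dirX σ (dirX σ f) = dirX τ (dirX τ f) + (σ - τ) • secondOne τ f +
      (σ - τ) ^ 2 • secondTwo τ f + (σ - τ) ^ 3 • secondThree τ f +
      (σ - τ) ^ 4 • pderiv 2 (pderiv 2 f) := by
  rw [dirX_eq σ τ (dirX σ f), dirX_eq σ τ f]
  simp only [map_add, Derivation.map_smul, secondOne, secondTwo, secondThree]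
  module

theorem osculant_identity {q₀ q₁ q₂ e₀ e₁ e₂ e₃ e₄ τ τ' : K} (h : τ ≠ τ')
    (hq : q₀ + τ * q₁ + τ ^ 2 * q₂ = 0) (hq' : q₀ + τ' * q₁ + τ' ^ 2 * q₂ = 0)
    (he : e₀ + τ * e₁ + τ ^ 2 * e₂ + τ ^ 3 * e₃ + τ ^ 4 * e₄ = 0)
    (he' : e₀ + τ' * e₁ + τ' ^ 2 * e₂ + τ' ^ 3 * e₃ + τ' ^ 4 * e₄ = 0) :
    q₂ ^ 3 * e₀ - q₀ * (q₂ ^ 2 * e₂ - q₁ * q₂ * e₃ + (q₁ ^ 2 - q₀ * q₂) * e₄) = 0 := by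
  have h' : τ - τ' ≠ 0 := sub_ne_zero.mpr h
  have h1 : q₁ = -q₂ * (τ + τ') := by
    apply mul_left_cancel₀ h'
    linear_combination hq - hq'
  have h0 : q₀ = q₂ * τ * τ' := by
    rw [h1] at hq
    linear_combination hq
  apply mul_left_cancel₀ h'
  rw [h1, h0]
  linear_combination q₂ ^ 3 * τ * he' - q₂ ^ 3 * τ' * he

theorem eval_first_of_restr_eq_zero {l : K × K × K} {f : MvPolynomial (Fin 3) K}
    (hf : restr l f = 0) (σ s : K) :
    eval (linePoint l s) (dirX σ f) + (l.1 - σ) * eval (linePoint l s) (dirY σ f) +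
      (l.1 - σ) ^ 2 * eval (linePoint l s) (pderiv 2 f) = 0 := by
  have h := derivative_restr l f
  rw [hf, Polynomial.derivative_zero] at h
  have h' := eval_restr l s (dirX l.1 f)
  rw [← h, Polynomial.eval_zero, dirX_eq l.1 σ f] at h'
  simpa using h'.symm

theorem eval_second_of_restr_eq_zero {l : K × K × K} {f : MvPolynomial (Fin 3) K}
    (hf : restr l f = 0) (σ s : K) :
    eval (linePoint l s) (dirX σ (dirX σ f)) + (l.1 - σ) * eval (linePoint l s) (secondOne σ f) +
      (l.1 - σ) ^ 2 * eval (linePoint l s) (secondTwo σ f) +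
      (l.1 - σ) ^ 3 * eval (linePoint l s) (secondThree σ f) +
      (l.1 - σ) ^ 4 * eval (linePoint l s) (pderiv 2 (pderiv 2 f)) = 0 := by
  have h := derivative_restr l f
  rw [hf, Polynomial.derivative_zero] at h
  have h2 := derivative_restr l (dirX l.1 f)
  rw [← h, Polynomial.derivative_zero] at h2
  have h' := eval_restr l s (dirX l.1 (dirX l.1 f))
  rw [← h2, Polynomial.eval_zero, dirX_dirX_eq l.1 σ f] at h'
  simpa using h'.symm

theorem eval_osculant_of_crossing {l l' : K × K × K} {f : MvPolynomial (Fin 3) K}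
    (hf : restr l f = 0) (hf' : restr l' f = 0) (σ s : K) (hne : l' ≠ l)
    (h : linePoint l' s = linePoint l s) : eval (linePoint l s) (osculant σ f) = 0 := by
  have hσ : l'.1 - σ ≠ l.1 - σ := fun h0 =>
    ((linePoint_eq_iff hne).mp h).1 (sub_left_injective h0)
  have a1 := eval_first_of_restr_eq_zero hf σ s
  have a2 := eval_second_of_restr_eq_zero hf σ s
  have b1 := eval_first_of_restr_eq_zero hf' σ s
  have b2 := eval_second_of_restr_eq_zero hf' σ s
  rw [h] at b1 b2
  simpa [osculant, cofactor] using osculant_identity hσ b1 a1 b2 a2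
end Osculation
section KeyLemma
open MvPolynomial

variable {K : Type*} [Field K]

/-- Each line of `L` meets the others in many points, in terms of `|L|` and a parameter `B`. -/
def Rich (B : ℕ) (L : Finset (K × K × K)) : Prop :=
  ∀ l ∈ L, 10 ^ 7 * L.card.sqrt + B ≤ (crossings L l).card

/-- If the lines of `L` form a minimal rich family then a polynomial `f` of minimal degree
vanishing on `L` divides every polynomial of small degree vanishing on `L`. -/
theorem dvd_of_minimal [Infinite K] {B : ℕ} {L : Finset (K × K × K)} (hL : Rich B L)
    (hmin : ∀ M ⊆ L, M.Nonempty → Rich B M → L.card ≤ M.card) {f g : MvPolynomial (Fin 3) K}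
    (hf : f ≠ 0) (hfL : ∀ l ∈ L, restr l f = 0) (hd : 8 * f.totalDegree ≤ L.card.sqrt)
    (hfmin : ∀ h : MvPolynomial (Fin 3) K, h ≠ 0 → (∀ l ∈ L, restr l h = 0) →
      f.totalDegree ≤ h.totalDegree)
    (hgL : ∀ l ∈ L, restr l g = 0) (hgd : g.totalDegree ≤ 4 * f.totalDegree)
    (hpos : 0 < L.card) : f ∣ g := by
  classical
  by_cases hg : g = 0
  · simp [hg]
  obtain ⟨f', g', h, hrel, rfl, rfl⟩ := UniqueFactorizationMonoid.exists_reduced_factors f hf g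
  have hh0 : h ≠ 0 := left_ne_zero_of_mul hf
  have hf0 : f' ≠ 0 := right_ne_zero_of_mul hf
  have hg0 : g' ≠ 0 := right_ne_zero_of_mul hg
  rw [totalDegree_mul_of_isDomain hh0 hf0] at *
  rw [totalDegree_mul_of_isDomain hh0 hg0] at hgd
  have hsq := Nat.sqrt_le' L.card
  have hsqpos : 0 < L.card.sqrt := Nat.sqrt_pos.mpr hpos
  set k := L.card.sqrt with hk
  set M := L.filter fun l => restr l h ≠ 0 with hM
  have hMcard : M.card ≤ (h.totalDegree + f'.totalDegree) *
      (4 * (h.totalDegree + f'.totalDegree)) := by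
    refine (card_common_lines_le hf0 hg0 hrel M fun l hl s => ?_).trans
      (Nat.mul_le_mul (by omega) (by omega))
    obtain ⟨hl, hl0⟩ := Finset.mem_filter.mp hl
    have h1 := hfL l hl
    have h2 := hgL l hl
    rw [map_mul] at h1 h2
    rw [← eval_restr, ← eval_restr, (mul_eq_zero.mp h1).resolve_left hl0,
      (mul_eq_zero.mp h2).resolve_left hl0]
    simp
  set d := h.totalDegree + f'.totalDegree with hdd
  have hMsq : M.card.sqrt ≤ 2 * d := by
    have := Nat.sqrt_le_sqrt hMcard
    rwa [show d * (4 * d) = (2 * d) ^ 2 by ring, Nat.sqrt_eq'] at this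
  have hMrich : Rich B M := by
    intro l hl
    obtain ⟨hlL, hl0⟩ := Finset.mem_filter.mp hl
    have hsub : crossings L l ⊆ crossings M l ∪ (restr l h).roots.toFinset := by
      intro s hs
      by_cases hr : (restr l h).eval s = 0
      · exact Finset.mem_union_right _ (by simp [hl0, hr])
      · refine Finset.mem_union_left _ ?_
        obtain ⟨l', hl', hne, hp⟩ := mem_crossings.mp hs
        refine mem_crossings.mpr ⟨l', Finset.mem_filter.mpr ⟨hl', fun h0 => hr ?_⟩, hne, hp⟩
        rw [eval_restr, ← hp, ← eval_restr, h0, Polynomial.eval_zero]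
    have h1 := (Finset.card_le_card hsub).trans (Finset.card_union_le _ _)
    have h2 := (Multiset.toFinset_card_le _).trans ((restr l h).card_roots'.trans
      (natDegree_restr_le l h))
    have h3 := hL l hlL
    omega
  rcases M.eq_empty_or_nonempty with hM0 | hM0
  · have hhL : ∀ l ∈ L, restr l h = 0 := by
      intro l hl
      by_contra h0
      have : l ∈ M := Finset.mem_filter.mpr ⟨hl, h0⟩
      simp [hM0] at this
    have h1 := hfmin h hh0 hhL
    have h2 : f'.totalDegree = 0 := by omega
    rw [totalDegree_eq_zero_iff_eq_C] at h2
    have hc : coeff 0 f' ≠ 0 := by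
      intro h0
      rw [h0, C_0] at h2
      exact hf0 h2
    have hu : IsUnit f' := by
      rw [h2]
      exact (isUnit_iff_ne_zero.mpr hc).map C
    exact mul_dvd_mul_left h hu.dvd
  · have := hmin M (Finset.filter_subset _ _) hM0 hMrich
    nlinarith

/-- The structure of a minimal rich family of lines. -/
theorem exists_line_of_minimal [Infinite K] {B : ℕ} {L : Finset (K × K × K)} (hne : L.Nonempty)
    (hL : Rich B L) (hmin : ∀ M ⊆ L, M.Nonempty → Rich B M → L.card ≤ M.card)
    (hchar : ∀ j : ℕ, 0 < j → 16 * j ^ 2 ≤ L.card → (j : K) ≠ 0) :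
    ∃ l ∈ L, ∃ c γ : K, ∃ Z ⊆ crossings L l, B < Z.card ∧ ∀ s ∈ Z, ∀ l' ∈ L, l' ≠ l →
      linePoint l' s = linePoint l s → 1 + (γ - c * s) * (l'.1 - l.1) = 0 := by
  classical
  have hpos := hne.card_pos
  have hsq := Nat.sqrt_le' L.card
  have hsq' := Nat.lt_succ_sqrt' L.card
  have hsqpos : 0 < L.card.sqrt := Nat.sqrt_pos.mpr hpos
  set k := L.card.sqrt with hk
  -- a polynomial of minimal degree
  obtain ⟨f₀, hf₀, hf₀d, hf₀L⟩ := exists_restr_eq_zero L (k / 8) (10 ^ 7 * k)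
    (by
      have : k + 1 ≤ 8 * (k / 8 + 1) := by omega
      have := Nat.pow_le_pow_left this 2
      rw [Nat.succ_eq_add_one] at hsq'
      nlinarith)
    (by
      have : k ≤ L.card := Nat.sqrt_le_self _
      omega) (by omega) (fun l hl => le_trans (by omega) (hL l hl))
  let P : ℕ → Prop := fun n => ∃ f : MvPolynomial (Fin 3) K, f ≠ 0 ∧ (∀ l ∈ L, restr l f = 0) ∧
    f.totalDegree = n
  have hP : ∃ n, P n := ⟨_, f₀, hf₀, hf₀L, rfl⟩
  obtain ⟨f, hf, hfL, hfd⟩ := Nat.find_spec hP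
  have hfmin : ∀ h : MvPolynomial (Fin 3) K, h ≠ 0 → (∀ l ∈ L, restr l h = 0) →
      f.totalDegree ≤ h.totalDegree := fun h h0 hL => hfd ▸ Nat.find_min' hP ⟨h, h0, hL, rfl⟩
  have hd8 : 8 * f.totalDegree ≤ k := by
    have := hfmin f₀ hf₀ hf₀L
    omega
  have hd0 : f.totalDegree ≠ 0 := by
    intro h0
    obtain ⟨l, hl⟩ := hne
    rw [totalDegree_eq_zero_iff_eq_C] at h0
    have := hfL l hl
    rw [h0, restr, aeval_C, ← Polynomial.C_eq_algebraMap, Polynomial.C_eq_zero] at this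
    rw [this, C_0] at h0
    exact hf h0
  have hch : ∀ j : ℕ, 0 < j → j ≤ 2 * f.totalDegree → (j : K) ≠ 0 := by
    intro j hj hj'
    refine hchar j hj ?_
    have : 4 * j ≤ k := by omega
    have := Nat.pow_le_pow_left this 2
    nlinarith
  set d := f.totalDegree with hd
  -- a line along which the gradient does not vanish
  obtain ⟨i, hi⟩ := exists_pderiv_ne_zero hd0 fun j hj hj' => hch j hj (by omega)
  obtain ⟨l, hl, hil⟩ : ∃ l ∈ L, restr l (pderiv i f) ≠ 0 := by
    by_contra! h
    exact absurd (hfmin _ hi h) (not_le.mpr (totalDegree_pderiv_lt hi))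
  have hQ : ∀ l ∈ L, 4 * d < (crossings L l).card := fun l hl =>
    lt_of_lt_of_le (by omega) (hL l hl)
  set σ := l.1 with hσ
  have hU : f ∣ osculant σ f := by
    refine dvd_of_minimal hL hmin hf hfL hd8 hfmin (fun m hm => ?_)
      (totalDegree_osculant_le σ f) hpos
    refine restr_eq_zero_of_card (crossings L m) (fun s hs => ?_)
      ((totalDegree_osculant_le σ f).trans_lt (hQ m hm))
    obtain ⟨m', hm', hne, hp⟩ := mem_crossings.mp hs
    exact eval_osculant_of_crossing (hfL m hm) (hfL m' hm') σ s hne hp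
  have hX : restr l (dirX σ f) = 0 := by rw [hσ, ← derivative_restr, hfL l hl, map_zero]
  have hXX : restr l (dirX σ (dirX σ f)) = 0 := by rw [hσ, ← derivative_restr, ← hσ, hX, map_zero]
  set p := restr l (dirY σ f) with hp
  set q := restr l (pderiv 2 f) with hq
  have hp' : restr l (dirX σ (dirY σ f)) = Polynomial.derivative p := (derivative_restr l _).symm
  have hq' : restr l (dirX σ (pderiv 2 f)) = Polynomial.derivative q := (derivative_restr l _).symm
  have hpd : p.natDegree < d := by
    have : p.natDegree ≤ d - 1 := (natDegree_restr_le l _).trans (totalDegree_dirY_le σ f)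
    omega
  have hqd : q.natDegree < d := by
    have : q.natDegree ≤ d - 1 := (natDegree_restr_le l _).trans (totalDegree_pderiv_le 2 f)
    omega
  -- tangency at the crossings of `l`
  have htan : ∀ s, ∀ l' ∈ L, l' ≠ l → linePoint l' s = linePoint l s →
      p.eval s + (l'.1 - σ) * q.eval s = 0 := by
    intro s l' hl' hne h
    have h1 := eval_first_of_restr_eq_zero (hfL l' hl') σ s
    rw [h, ← eval_restr, ← eval_restr, ← eval_restr, hX, Polynomial.eval_zero] at h1
    have h2 : l'.1 - σ ≠ 0 := sub_ne_zero.mpr ((linePoint_eq_iff hne).mp h).1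
    apply mul_left_cancel₀ h2
    linear_combination h1
  have hpq : ¬(p = 0 ∧ q = 0) := by
    rintro ⟨h1, h2⟩
    have e1 : restr l (pderiv 1 f) = 0 := by
      simpa [dirY, h2, h1, ← hq] using hp.symm
    have e0 : restr l (pderiv 0 f) = 0 := by
      simpa [dirX, e1, h2, ← hq] using hX
    fin_cases i
    · exact hil e0
    · exact hil e1
    · exact hil h2
  have hzero : ∀ r : Polynomial K, r.natDegree < d →
      (∀ s ∈ crossings L l, r.eval s = 0) → r = 0 := fun r hr h =>
    Polynomial.eq_zero_of_natDegree_lt_card_of_eval_eq_zero' _ (crossings L l) h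
      (by have := hQ l hl; omega)
  have hp0 : p ≠ 0 := fun h0 => hpq ⟨h0, hzero q hqd fun s hs => by
    obtain ⟨l', hl', hne, h⟩ := mem_crossings.mp hs
    have := htan s l' hl' hne h
    rw [h0, Polynomial.eval_zero, zero_add] at this
    exact (mul_eq_zero.mp this).resolve_left
      (sub_ne_zero.mpr ((linePoint_eq_iff hne).mp h).1)⟩
  have hq0 : q ≠ 0 := fun h0 => hpq ⟨hzero p hpd fun s hs => by
    obtain ⟨l', hl', hne, h⟩ := mem_crossings.mp hs
    simpa [h0] using htan s l' hl' hne h, h0⟩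
  -- the second order relation along `l`
  set b := restr l (cofactor σ f) with hb
  have hb' : b = q ^ 2 * restr l (secondTwo σ f) - p * q * restr l (secondThree σ f) +
      p ^ 2 * restr l (pderiv 2 (pderiv 2 f)) := by
    simp only [hb, cofactor, map_add, map_sub, map_mul, map_pow, hX, ← hp, ← hq]
    ring
  have hrel₁ : q ^ 3 * (2 * Polynomial.derivative p) = p * b := by
    have e1 : restr l (secondOne σ f) = 2 * Polynomial.derivative p := by
      rw [secondOne, ← dirX_dirY, map_add, hp']
      ring
    have : restr l (pderiv 2 f ^ 3 * secondOne σ f - dirY σ f * cofactor σ f) = 0 := by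
      refine restr_eq_zero_of_card (crossings L l) (fun s hs => ?_) (lt_of_le_of_lt ?_ (hQ l hl))
      · obtain ⟨l', hl', hne, h⟩ := mem_crossings.mp hs
        have h1 := htan s l' hl' hne h
        have h2 := eval_second_of_restr_eq_zero (hfL l' hl') σ s
        have h3 : l'.1 - σ ≠ 0 := sub_ne_zero.mpr ((linePoint_eq_iff hne).mp h).1
        rw [h, ← eval_restr, hXX, Polynomial.eval_zero] at h2
        rw [← eval_restr, map_sub, map_mul, map_mul, map_pow, ← hp, ← hq, ← hb, hb']
        simp only [← eval_restr] at h2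
        simp only [Polynomial.eval_sub, Polynomial.eval_mul, Polynomial.eval_pow,
          Polynomial.eval_add]
        apply mul_left_cancel₀ h3
        have h4 : p.eval s = -((l'.1 - σ) * q.eval s) := by linear_combination h1
        rw [h4]
        linear_combination q.eval s ^ 3 * h2
      · refine totalDegree_sub_le_of_le ?_ ?_
        · refine (totalDegree_mul_le_of_le (totalDegree_pow _ _)
            (totalDegree_secondOne_le σ f)).trans ?_
          have := totalDegree_pderiv_le' f 2
          omega
        · refine (totalDegree_mul_le_of_le (totalDegree_dirY_le' σ f)
            (totalDegree_cofactor_le σ f)).trans ?_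
          omega
    rw [map_sub, map_mul, map_mul, map_pow, ← hp, ← hq, ← hb, e1] at this
    exact sub_eq_zero.mp this
  -- the osculant vanishes to first order along `l`
  have hrel₂ : q * (q ^ 3 * Polynomial.derivative (Polynomial.derivative p) -
      Polynomial.derivative p * b) = p * (q ^ 3 * Polynomial.derivative (Polynomial.derivative q) -
      Polynomial.derivative q * b) := by
    obtain ⟨g, hg⟩ := hU
    have eY : restr l (dirY σ (osculant σ f)) =
        q ^ 3 * Polynomial.derivative (Polynomial.derivative p) - Polynomial.derivative p * b := by
      have hYX : restr l (dirY σ (dirX σ f)) = Polynomial.derivative p := by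
        rw [← dirX_dirY, hp']
      have hYXX : restr l (dirY σ (dirX σ (dirX σ f))) =
          Polynomial.derivative (Polynomial.derivative p) := by
        rw [← dirX_dirY, ← dirX_dirY, hσ, ← derivative_restr, ← hσ, hp']
      simp only [osculant, map_sub, Derivation.leibniz, smul_eq_mul, map_add, map_mul, map_pow, hX,
        hXX, hYX, hYXX, ← hq, ← hb]
      ring
    have eZ : restr l (pderiv 2 (osculant σ f)) =
        q ^ 3 * Polynomial.derivative (Polynomial.derivative q) - Polynomial.derivative q * b := by
      have hZX : restr l (pderiv 2 (dirX σ f)) = Polynomial.derivative q := by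
        rw [← dirX_pderiv_two, hq']
      have hZXX : restr l (pderiv 2 (dirX σ (dirX σ f))) =
          Polynomial.derivative (Polynomial.derivative q) := by
        rw [← dirX_pderiv_two, ← dirX_pderiv_two, hσ, ← derivative_restr, ← hσ, hq']
      simp only [osculant, map_sub, Derivation.leibniz, smul_eq_mul, map_add, map_mul, map_pow, hX,
        hXX, hZX, hZXX, ← hq, ← hb]
      ring
    have fY : restr l (dirY σ (osculant σ f)) = restr l g * p := by
      rw [hg, Derivation.leibniz, smul_eq_mul, smul_eq_mul, map_add, map_mul, map_mul,
        hfL l hl, zero_mul, zero_add]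
    have fZ : restr l (pderiv 2 (osculant σ f)) = restr l g * q := by
      rw [hg, Derivation.leibniz, smul_eq_mul, smul_eq_mul, map_add, map_mul, map_mul,
        hfL l hl, zero_mul, zero_add]
    rw [← eY, ← eZ, fY, fZ]
    ring
  obtain ⟨c, γ, hcγ⟩ := exists_linear_ratio hch hp0 hq0 hpd hqd hrel₁ hrel₂
  refine ⟨l, hl, c, γ, crossings L l \ p.roots.toFinset, Finset.sdiff_subset, ?_, ?_⟩
  · have h1 := Finset.le_card_sdiff p.roots.toFinset (crossings L l)
    have h2 := (Multiset.toFinset_card_le _).trans p.card_roots'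
    have h3 := hL l hl
    omega
  · intro s hs l' hl' hne h
    have hps : p.eval s ≠ 0 := by
      intro h0
      exact (Finset.mem_sdiff.mp hs).2 (by simp [hp0, h0])
    have h1 := htan s l' hl' hne h
    apply mul_left_cancel₀ hps
    rw [hcγ] at h1
    simp only [Polynomial.eval_mul, Polynomial.eval_sub, Polynomial.eval_C,
      Polynomial.eval_X] at h1
    linear_combination h1
end KeyLemma
section Segments

variable {K : Type*} [Field K]

/-- The distance in isotropic coordinates. -/
def isoDist (a b : K × K) : K := (a.1 - b.1) * (a.2 - b.2)

open Classical in
/-- No line contains more than `M` points of `A`, and neither does any circle of nonzero radius;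
everything in isotropic coordinates. -/
def PlanarBound (A : Finset (K × K)) (M : ℕ) : Prop :=
  (∀ x, (A.filter fun a => a.1 = x).card ≤ M) ∧
  (∀ α β, (A.filter fun a => a.2 = α + β * a.1).card ≤ M) ∧
  ∀ x y ρ, ρ ≠ 0 → (A.filter fun a => (a.1 - x) * (a.2 - y) = ρ).card ≤ M

open Classical in
/-- The segments of length `r` with both end points in `A`, encoded by `(z, w, σ)`, where `(z, w)`
is the first end point and `(z + σ⁻¹, w + r * σ)` the second one. -/
noncomputable def segments (A : Finset (K × K)) (r : K) : Finset (K × K × K) :=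
  ((A ×ˢ A).filter fun b => isoDist b.2 b.1 = r).image
    fun b => (b.1.1, b.1.2, (b.2.1 - b.1.1)⁻¹)

variable {A : Finset (K × K)} {r : K}

open Classical in
theorem mem_segments (hr : r ≠ 0) {P : K × K × K} :
    P ∈ segments A r ↔ P.2.2 ≠ 0 ∧ (P.1, P.2.1) ∈ A ∧ (P.1 + P.2.2⁻¹, P.2.1 + r * P.2.2) ∈ A := by
  obtain ⟨z, w, σ⟩ := P
  rw [segments, Finset.mem_image]
  constructor
  · rintro ⟨⟨⟨b1, b2⟩, ⟨c1, c2⟩⟩, hbc, heq⟩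
    obtain ⟨hA, h⟩ := Finset.mem_filter.mp hbc
    obtain ⟨hb, hc⟩ := Finset.mem_product.mp hA
    simp only [Prod.mk.injEq, isoDist] at heq h hb hc ⊢
    obtain ⟨rfl, rfl, rfl⟩ := heq
    have h1 : c1 - b1 ≠ 0 := fun h0 => hr (by rw [← h, h0, zero_mul])
    refine ⟨inv_ne_zero h1, hb, ?_⟩
    convert hc using 2
    · rw [inv_inv]; ring
    · rw [← h]; field_simp; ring
  · rintro ⟨hσ, hb, hc⟩
    simp only at hσ
    refine ⟨⟨(z, w), (z + σ⁻¹, w + r * σ)⟩,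
      Finset.mem_filter.mpr ⟨Finset.mem_product.mpr ⟨hb, hc⟩, ?_⟩, by simp⟩
    simp only [isoDist]
    field_simp
    ring

open Classical in
theorem card_segments (hr : r ≠ 0) :
    (segments A r).card = ((A ×ˢ A).filter fun b => isoDist b.2 b.1 = r).card := by
  rw [segments, Finset.card_image_of_injOn]
  rintro ⟨⟨b1, b2⟩, ⟨c1, c2⟩⟩ hb ⟨⟨b1', b2'⟩, ⟨c1', c2'⟩⟩ hb' heq
  replace hb := (Finset.mem_filter.mp (Finset.mem_coe.mp hb)).2
  replace hb' := (Finset.mem_filter.mp (Finset.mem_coe.mp hb')).2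
  simp only [isoDist] at hb hb'
  simp only [Prod.mk.injEq, inv_inj] at heq
  obtain ⟨rfl, rfl, h⟩ := heq
  have h1 : c1 = c1' := sub_left_injective h
  subst h1
  have h2 : c1 - b1 ≠ 0 := fun h0 => hr (by rw [← hb, h0, zero_mul])
  have h3 := mul_left_cancel₀ h2 (hb.trans hb'.symm)
  rw [sub_left_injective h3]

theorem card_segment_family_le {M : ℕ} (hA : PlanarBound A M) (hr : r ≠ 0) {z₀ w₀ σ₀ c γ k : K}
    (hσ₀ : σ₀ ≠ 0) (hk : c = 0 → γ = 0 → k ≠ 0) (X : Finset (K × K × K))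
    (hX : ∀ P ∈ X, P ∈ segments A r ∧ P.2.1 = w₀ - r * σ₀ * P.2.2 * (P.1 - z₀) ∧
      P.2.2 * (c * P.1 - γ) = k) : X.card ≤ M := by
  classical
  obtain ⟨hA1, hA2, hA3⟩ := hA
  have hfst : ∀ s : Finset (K × K), s.card ≤ M → (∀ P ∈ X, (P.1, P.2.1) ∈ s) →
      (∀ P ∈ X, ∀ P' ∈ X, P.1 = P'.1 → P.2.1 = P'.2.1 → P.2.2 = P'.2.2) → X.card ≤ M := by
    intro s hs h1 h2
    refine (Finset.card_le_card_of_injOn (fun P => (P.1, P.2.1))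
      (fun P hP => h1 P hP) ?_).trans hs
    intro P hP P' hP' h
    simp only [Prod.mk.injEq] at h
    exact Prod.ext h.1 (Prod.ext h.2 (h2 P hP P' hP' h.1 h.2))
  have hmem : ∀ P ∈ X, (P.1, P.2.1) ∈ A := fun P hP => ((mem_segments hr).mp (hX P hP).1).2.1
  have hne : ∀ P ∈ X, P.2.2 ≠ 0 := fun P hP => ((mem_segments hr).mp (hX P hP).1).1
  by_cases hc : c = 0
  · subst hc
    by_cases hγ : γ = 0
    · subst hγ
      suffices X = ∅ by simp [this]
      refine Finset.eq_empty_of_forall_notMem fun P hP => hk rfl rfl ?_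
      rw [← (hX P hP).2.2]
      ring
    · have hσ : ∀ P ∈ X, P.2.2 = -k / γ := fun P hP => by
        rw [eq_div_iff hγ, ← (hX P hP).2.2]
        ring
      refine hfst _ (hA2 (w₀ + r * σ₀ * (-k / γ) * z₀) (-(r * σ₀ * (-k / γ)))) ?_ ?_
      · intro P hP
        refine Finset.mem_filter.mpr ⟨hmem P hP, ?_⟩
        simp only
        rw [(hX P hP).2.1, hσ P hP]
        ring
      · intro P hP P' hP' _ _
        rw [hσ P hP, hσ P' hP']
  by_cases hk0 : k = 0
  · subst hk0
    have hz : ∀ P ∈ X, P.1 = γ / c := fun P hP => by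
      rw [eq_div_iff hc]
      have := (mul_eq_zero.mp (hX P hP).2.2).resolve_left (hne P hP)
      linear_combination this
    by_cases hζ : γ / c = z₀
    · have hw : ∀ P ∈ X, P.2.1 = w₀ := fun P hP => by
        rw [(hX P hP).2.1, hz P hP, hζ]
        ring
      refine (Finset.card_le_card_of_injOn (fun P => (P.1 + P.2.2⁻¹, P.2.1 + r * P.2.2))
        (fun P hP => ?_) ?_).trans (hA3 z₀ w₀ r hr)
      · refine Finset.mem_coe.mpr (Finset.mem_filter.mpr
          ⟨((mem_segments hr).mp (hX P hP).1).2.2, ?_⟩)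
        simp only
        rw [hw P hP, hz P hP, hζ]
        have := hne P hP
        field_simp
        ring
      · intro P hP P' hP' h
        simp only [Prod.mk.injEq, hw P hP, hw P' hP', hz P hP, hz P' hP'] at h
        exact Prod.ext ((hz P hP).trans (hz P' hP').symm) (Prod.ext
          ((hw P hP).trans (hw P' hP').symm) (inv_injective (add_left_cancel h.1)))
    · refine hfst _ (hA1 (γ / c)) (fun P hP => Finset.mem_filter.mpr ⟨hmem P hP, hz P hP⟩) ?_
      intro P hP P' hP' h1 h2
      have e1 := (hX P hP).2.1
      have e2 := (hX P' hP').2.1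
      rw [h2, e2, ← h1, hz P hP] at e1
      have h3 : r * σ₀ * (γ / c - z₀) ≠ 0 :=
        mul_ne_zero (mul_ne_zero hr hσ₀) (sub_ne_zero.mpr hζ)
      apply mul_left_cancel₀ h3
      linear_combination e1
  · have hσ : ∀ P ∈ X, ∀ P' ∈ X, P.1 = P'.1 → P.2.1 = P'.2.1 → P.2.2 = P'.2.2 := by
      intro P hP P' hP' h1 _
      have e1 := (hX P hP).2.2
      have e2 := (hX P' hP').2.2
      rw [← h1] at e2
      have h3 : c * P.1 - γ ≠ 0 := fun h0 => hk0 (by rw [← e1, h0, mul_zero])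
      exact mul_right_cancel₀ h3 (e1.trans e2.symm)
    have hcirc : ∀ P ∈ X, (P.1 - γ / c) * (P.2.1 - (w₀ - r * σ₀ * k / c)) =
        -(r * σ₀ * k / c) * (γ / c - z₀) := by
      intro P hP
      obtain ⟨-, e1, e2⟩ := hX P hP
      rw [e1]
      field_simp
      rw [← e2]
      ring
    by_cases hρ : -(r * σ₀ * k / c) * (γ / c - z₀) = 0
    · refine hfst _ (hA2 (w₀ - r * σ₀ * k / c) 0) ?_ hσ
      intro P hP
      refine Finset.mem_filter.mpr ⟨hmem P hP, ?_⟩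
      have h1 := hcirc P hP
      rw [hρ] at h1
      have h2 : P.1 - γ / c ≠ 0 := by
        intro h0
        apply hk0
        rw [← (hX P hP).2.2, sub_eq_zero.mp h0]
        field_simp
        ring
      have := (mul_eq_zero.mp h1).resolve_left h2
      linear_combination this
    · exact hfst _ (hA3 _ _ _ hρ) (fun P hP => Finset.mem_filter.mpr ⟨hmem P hP, hcirc P hP⟩) hσ

/-- The line in `K³` attached to a segment. -/
def segLine (r η : K) (P : K × K × K) : K × K × K :=
  (P.2.2, -η - P.2.2 * P.1, P.2.1 / r - 2 * η * P.2.2 - P.2.2 ^ 2 * P.1)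

theorem segLine_injOn (hr : r ≠ 0) (η : K) : Set.InjOn (segLine r η) (segments A r) := by
  intro P hP P' hP' h
  simp only [segLine, Prod.mk.injEq] at h
  obtain ⟨h1, h2, h3⟩ := h
  have hσ := ((mem_segments hr).mp hP).1
  rw [← h1] at h2 h3
  have h4 : P.1 = P'.1 := by
    apply mul_left_cancel₀ hσ
    linear_combination -h2
  rw [h4] at h3
  have h5 : P.2.1 = P'.2.1 := by
    have : P.2.1 / r = P'.2.1 / r := by linear_combination h3
    exact (div_left_inj' hr).mp this
  exact Prod.ext h4 (Prod.ext h5 h1)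

/-- The incidence relation between segments coming from a common reflection. -/
def SegRel (r : K) (P P' : K × K × K) : Prop :=
  P.2.1 - P'.2.1 = r * P.2.2 * P'.2.2 * (P'.1 - P.1)

theorem segRel_of_crossing (hr : r ≠ 0) {η s : K} {P P' : K × K × K}
    (hne : segLine r (-η) P' ≠ segLine r η P)
    (h : linePoint (segLine r (-η) P') s = linePoint (segLine r η P) s) :
    P'.2.2 ≠ P.2.2 ∧ SegRel r P P' ∧
      s * (P'.2.2 - P.2.2) = -2 * η - P.2.2 * P.1 + P'.2.2 * P'.1 := by
  obtain ⟨h1, h2, h3⟩ := (linePoint_eq_iff hne).mp h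
  simp only [segLine] at h1 h2 h3
  refine ⟨h1, ?_, ?_⟩
  · have : (P.2.1 - P'.2.1) / r = P.2.2 * P'.2.2 * (P'.1 - P.1) := by
      rw [sub_div]
      linear_combination h2
    rw [SegRel, (div_eq_iff hr).mp this]
    ring
  · rw [h3, div_mul_cancel₀ _ (sub_ne_zero.mpr h1)]
    ring

theorem exists_crossing_of_segRel (hr : r ≠ 0) {P P' : K × K × K} (hσ : P'.2.2 ≠ P.2.2)
    (h : SegRel r P P') (η : K) :
    ∃ s, linePoint (segLine r (-η) P') s = linePoint (segLine r η P) s := by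
  have hne : segLine r (-η) P' ≠ segLine r η P := fun h0 => hσ (congrArg Prod.fst h0)
  refine ⟨_, (linePoint_eq_iff hne).mpr ⟨hσ, ?_, rfl⟩⟩
  have : (P.2.1 - P'.2.1) / r = P.2.2 * P'.2.2 * (P'.1 - P.1) := by
    rw [div_eq_iff hr, h]
    ring
  rw [sub_div] at this
  simp only [segLine]
  linear_combination this

/-- For a generic choice of `η` the lines attached to the segments are pairwise skew. -/
theorem exists_generic [Infinite K] (h2 : (2 : K) ≠ 0) (r : K) (T : Finset (K × K × K)) :
    ∃ η : K, ∀ ε ∈ ({η, -η} : Set K), ∀ P ∈ T, ∀ P' ∈ T, segLine r ε P' ≠ segLine r ε P →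
      ∀ s, linePoint (segLine r ε P') s ≠ linePoint (segLine r ε P) s := by
  classical
  let bad : (K × K × K) × (K × K × K) → K := fun q =>
    ((q.1.2.1 - q.2.2.1) / r - q.1.2.2 * q.2.2.2 * (q.2.1 - q.1.1)) / (2 * (q.1.2.2 - q.2.2.2))
  obtain ⟨η, hη⟩ := Infinite.exists_notMem_finset
    ((T ×ˢ T).image bad ∪ (T ×ˢ T).image fun q => -bad q)
  simp only [Finset.mem_union, Finset.mem_image, Finset.mem_product, not_or, not_exists,
    not_and] at hη
  have hgen : ∀ ε, (∀ q : (K × K × K) × (K × K × K), q.1 ∈ T ∧ q.2 ∈ T → bad q ≠ ε) →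
      ∀ P ∈ T, ∀ P' ∈ T, segLine r ε P' ≠ segLine r ε P →
      ∀ s, linePoint (segLine r ε P') s ≠ linePoint (segLine r ε P) s := by
    intro ε hε P hP P' hP' hne s h
    obtain ⟨h1, h2', -⟩ := (linePoint_eq_iff hne).mp h
    apply hε (P, P') ⟨hP, hP'⟩
    simp only [segLine] at h1 h2'
    have h3 : 2 * (P.2.2 - P'.2.2) ≠ 0 := mul_ne_zero h2 (sub_ne_zero.mpr h1.symm)
    simp only [bad]
    rw [div_eq_iff h3, sub_div]
    linear_combination h2'
  refine ⟨η, fun ε hε => ?_⟩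
  rcases hε with rfl | rfl
  · exact hgen _ fun q hq => hη.1 q hq
  · exact hgen _ fun q hq h => hη.2 q hq (by rw [h, neg_neg])

end Segments
section Incidences

variable {K : Type*} [Field K] {A : Finset (K × K)} {r : K}

/-- The lines attached to a set of segments are pairwise skew. -/
def PairwiseSkew (r ε : K) (T : Finset (K × K × K)) : Prop :=
  ∀ P ∈ T, ∀ P' ∈ T, segLine r ε P' ≠ segLine r ε P →
    ∀ s, linePoint (segLine r ε P') s ≠ linePoint (segLine r ε P) s

theorem SegRel.symm {P P' : K × K × K} (h : SegRel r P P') : SegRel r P' P := by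
  rw [SegRel] at *
  linear_combination -h

open Classical in
theorem card_pencil_le {M : ℕ} (hA : PlanarBound A M) (hr : r ≠ 0) {ε : K}
    (hgen : PairwiseSkew r ε (segments A r)) {P₀ : K × K × K} (hP₀ : P₀ ∈ segments A r)
    {L : Finset (K × K × K)}
    (hL : ∀ l ∈ L, ∃ P ∈ segments A r, l = segLine r ε P ∨ l = segLine r (-ε) P)
    {Z : Finset K} (hZ : Z ⊆ crossings L (segLine r ε P₀)) {c γ : K}
    (h : ∀ s ∈ Z, ∀ l' ∈ L, l' ≠ segLine r ε P₀ →
      linePoint l' s = linePoint (segLine r ε P₀) s →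
      1 + (γ - c * s) * (l'.1 - (segLine r ε P₀).1) = 0) : Z.card ≤ M := by
  have key : ∀ s ∈ Z, ∃ P ∈ segments A r, SegRel r P₀ P ∧ P.2.2 ≠ P₀.2.2 ∧
      s * (P.2.2 - P₀.2.2) = -2 * ε - P₀.2.2 * P₀.1 + P.2.2 * P.1 ∧
      1 + (γ - c * s) * (P.2.2 - P₀.2.2) = 0 := by
    intro s hs
    obtain ⟨l', hl', hne, hpt⟩ := mem_crossings.mp (hZ hs)
    obtain ⟨P, hP, rfl | rfl⟩ := hL l' hl'
    · exact absurd hpt (hgen P₀ hP₀ P hP hne s)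
    · obtain ⟨h1, h2, h3⟩ := segRel_of_crossing hr hne hpt
      exact ⟨P, hP, h2, h1, h3, h s hs _ hl' hne hpt⟩
  choose! f hfT hfrel hfne hfs hfc using key
  have hinj : Set.InjOn f Z := by
    intro s hs s' hs' hss
    have e1 := hfs s hs
    have e2 := hfs s' hs'
    rw [← hss] at e2
    exact mul_right_cancel₀ (sub_ne_zero.mpr (hfne s hs)) (e1.trans e2.symm)
  rw [← Finset.card_image_of_injOn hinj]
  refine card_segment_family_le hA hr (z₀ := P₀.1) (w₀ := P₀.2.1) (σ₀ := P₀.2.2) (c := c) (γ := γ)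
    (k := 1 - γ * P₀.2.2 + c * (2 * ε + P₀.2.2 * P₀.1)) ((mem_segments hr).mp hP₀).1 ?_ _ ?_
  · rintro rfl rfl
    simp
  · intro P hP
    obtain ⟨s, hs, rfl⟩ := Finset.mem_image.mp hP
    refine ⟨hfT s hs, ?_, ?_⟩
    · have := hfrel s hs
      rw [SegRel] at this
      linear_combination -this
    · linear_combination -(hfc s hs) - c * hfs s hs

open Classical in
theorem not_rich [Infinite K] {M : ℕ} (hA : PlanarBound A M) (hr : r ≠ 0) {η : K}
    (hgen : ∀ ε ∈ ({η, -η} : Set K), PairwiseSkew r ε (segments A r))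
    (hchar : ∀ j : ℕ, 0 < j → 8 * j ^ 2 ≤ (segments A r).card → (j : K) ≠ 0)
    {L : Finset (K × K × K)} (hne : L.Nonempty)
    (hL : ∀ l ∈ L, ∃ P ∈ segments A r, l = segLine r η P ∨ l = segLine r (-η) P) :
    ¬ Rich M L := by
  intro hrich
  obtain ⟨L₀, hL₀, hmin⟩ := Finset.exists_min_image
    (L.powerset.filter fun L' => L'.Nonempty ∧ Rich M L') Finset.card
    ⟨L, Finset.mem_filter.mpr ⟨Finset.mem_powerset_self L, hne, hrich⟩⟩
  simp only [Finset.mem_filter, Finset.mem_powerset] at hL₀ hmin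
  obtain ⟨hsub, hne₀, hrich₀⟩ := hL₀
  have hcard : L₀.card ≤ 2 * (segments A r).card := by
    have h1 : L₀ ⊆ (segments A r).image (segLine r η) ∪ (segments A r).image (segLine r (-η)) := by
      intro l hl
      obtain ⟨P, hP, rfl | rfl⟩ := hL l (hsub hl)
      · exact Finset.mem_union_left _ (Finset.mem_image_of_mem _ hP)
      · exact Finset.mem_union_right _ (Finset.mem_image_of_mem _ hP)
    refine (Finset.card_le_card h1).trans ((Finset.card_union_le _ _).trans ?_)
    have h2 := Finset.card_image_le (s := segments A r) (f := segLine r η)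
    have h3 := Finset.card_image_le (s := segments A r) (f := segLine r (-η))
    lia
  obtain ⟨l, hl, c, γ, Z, hZ, hB, h⟩ := exists_line_of_minimal hne₀ hrich₀
    (fun L' hL' hL'ne hL'r => hmin L' ⟨hL'.trans hsub, hL'ne, hL'r⟩)
    (fun j hj hjL => hchar j hj (by lia))
  refine absurd hB (not_lt.mpr ?_)
  obtain ⟨P₀, hP₀, rfl | rfl⟩ := hL l (hsub hl)
  · exact card_pencil_le hA hr (hgen η (by simp)) hP₀ (fun l hl => hL l (hsub hl)) hZ h
  · refine card_pencil_le hA hr (hgen (-η) (by simp)) hP₀ (fun l hl => ?_) hZ h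
    obtain ⟨P, hP, hPl⟩ := hL l (hsub hl)
    exact ⟨P, hP, by rwa [neg_neg, or_comm]⟩

open Classical in
theorem card_segRel_le_crossings (hr : r ≠ 0) {ε : K} {T : Finset (K × K × K)}
    (hgen : PairwiseSkew r (-ε) (segments A r)) {P₀ : K × K × K}
    (hT : T ⊆ segments A r) {L : Finset (K × K × K)} (hL : ∀ P ∈ T, segLine r (-ε) P ∈ L) :
    (T.filter fun P => SegRel r P₀ P ∧ P.2.2 ≠ P₀.2.2).card ≤
      (crossings L (segLine r ε P₀)).card := by
  have key : ∀ P ∈ T.filter fun P => SegRel r P₀ P ∧ P.2.2 ≠ P₀.2.2,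
      ∃ s, linePoint (segLine r (-ε) P) s = linePoint (segLine r ε P₀) s := by
    intro P hP
    obtain ⟨-, h1, h2⟩ := Finset.mem_filter.mp hP
    exact exists_crossing_of_segRel hr h2 h1 ε
  choose! f hf using key
  refine Finset.card_le_card_of_injOn f (fun P hP => ?_) fun P hP P' hP' hPP => ?_
  · have hP1 := Finset.mem_filter.mp hP
    exact Finset.mem_coe.mpr (mem_crossings.mpr ⟨_, hL P hP1.1,
      fun h0 => hP1.2.2 (congrArg Prod.fst h0), hf P hP⟩)
  · have hPT := hT (Finset.mem_filter.mp (Finset.mem_coe.mp hP)).1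
    have hPT' := hT (Finset.mem_filter.mp (Finset.mem_coe.mp hP')).1
    by_contra hne
    refine hgen P hPT P' hPT' (fun h0 => hne (segLine_injOn hr _ hPT hPT' h0.symm)) (f P') ?_
    rw [hf P' hP', ← hPP, hf P hP]

open Classical in
theorem card_segRel_prod_le [Infinite K] {M : ℕ} (hA : PlanarBound A M) (hr : r ≠ 0) {η : K}
    (hgen : ∀ ε ∈ ({η, -η} : Set K), PairwiseSkew r ε (segments A r))
    (hchar : ∀ j : ℕ, 0 < j → 8 * j ^ 2 ≤ (segments A r).card → (j : K) ≠ 0)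
    (N : ℕ) (T₁ T₂ : Finset (K × K × K)) (h₁ : T₁ ⊆ segments A r) (h₂ : T₂ ⊆ segments A r)
    (hN : T₁.card + T₂.card = N) :
    ((T₁ ×ˢ T₂).filter fun q => SegRel r q.1 q.2 ∧ q.2.2.2 ≠ q.1.2.2).card ≤
      N * (10 ^ 7 * (2 * (segments A r).card).sqrt + M) := by
  induction N generalizing T₁ T₂ with
  | zero =>
    have : T₁ = ∅ := by rw [← Finset.card_eq_zero]; lia
    simp [this]
  | succ N ih =>
    set L := T₁.image (segLine r η) ∪ T₂.image (segLine r (-η)) with hLdef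
    have hL : ∀ l ∈ L, ∃ P ∈ segments A r, l = segLine r η P ∨ l = segLine r (-η) P := by
      intro l hl
      rcases Finset.mem_union.mp hl with hl | hl
      · obtain ⟨P, hP, rfl⟩ := Finset.mem_image.mp hl
        exact ⟨P, h₁ hP, Or.inl rfl⟩
      · obtain ⟨P, hP, rfl⟩ := Finset.mem_image.mp hl
        exact ⟨P, h₂ hP, Or.inr rfl⟩
    have hL1 : ∀ P ∈ T₁, segLine r η P ∈ L := fun P hP =>
      Finset.mem_union_left _ (Finset.mem_image_of_mem _ hP)
    have hL2 : ∀ P ∈ T₂, segLine r (-η) P ∈ L := fun P hP =>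
      Finset.mem_union_right _ (Finset.mem_image_of_mem _ hP)
    have hLne : L.Nonempty := by
      rcases T₁.eq_empty_or_nonempty with h | ⟨P, hP⟩
      · rcases T₂.eq_empty_or_nonempty with h' | ⟨P, hP⟩
        · simp [h, h'] at hN
        · exact ⟨_, hL2 P hP⟩
      · exact ⟨_, hL1 P hP⟩
    have hLcard : L.card ≤ 2 * (segments A r).card := by
      refine (Finset.card_union_le _ _).trans ?_
      have e1 := (Finset.card_image_le (s := T₁) (f := segLine r η)).trans (Finset.card_le_card h₁)
      have e2 := (Finset.card_image_le (s := T₂) (f := segLine r (-η))).trans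
        (Finset.card_le_card h₂)
      lia
    have hnot := not_rich hA hr hgen hchar hLne hL
    simp only [Rich, not_forall, not_le] at hnot
    obtain ⟨l, hl, hlt⟩ := hnot
    have hB : (crossings L l).card ≤ 10 ^ 7 * (2 * (segments A r).card).sqrt + M := by
      have := Nat.sqrt_le_sqrt hLcard
      lia
    rcases Finset.mem_union.mp hl with hl | hl
    · obtain ⟨P₀, hP₀, rfl⟩ := Finset.mem_image.mp hl
      have hih := ih (T₁.erase P₀) T₂ ((Finset.erase_subset _ _).trans h₁) h₂
        (by rw [Finset.card_erase_of_mem hP₀]; have := Finset.card_pos.mpr ⟨P₀, hP₀⟩; lia)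
      have hdeg := card_segRel_le_crossings (P₀ := P₀) hr (hgen (-η) (by simp)) h₂ hL2
      have hsub : ((T₁ ×ˢ T₂).filter fun q => SegRel r q.1 q.2 ∧ q.2.2.2 ≠ q.1.2.2) ⊆
          (((T₁.erase P₀) ×ˢ T₂).filter fun q => SegRel r q.1 q.2 ∧ q.2.2.2 ≠ q.1.2.2) ∪
          (T₂.filter fun P => SegRel r P₀ P ∧ P.2.2 ≠ P₀.2.2).image fun P => (P₀, P) := by
        rintro ⟨P, P'⟩ hq
        simp only [Finset.mem_filter, Finset.mem_product, Finset.mem_union, Finset.mem_image,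
          Finset.mem_erase] at hq ⊢
        by_cases h : P = P₀
        · subst h
          exact Or.inr ⟨P', ⟨hq.1.2, hq.2⟩, rfl⟩
        · exact Or.inl ⟨⟨⟨h, hq.1.1⟩, hq.1.2⟩, hq.2⟩
      have h3 := (Finset.card_le_card hsub).trans (Finset.card_union_le _ _)
      have h4 := Finset.card_image_le (s := T₂.filter fun P => SegRel r P₀ P ∧ P.2.2 ≠ P₀.2.2)
        (f := fun P => (P₀, P))
      rw [Nat.succ_mul]
      lia
    · obtain ⟨P₀, hP₀, rfl⟩ := Finset.mem_image.mp hl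
      have hih := ih T₁ (T₂.erase P₀) h₁ ((Finset.erase_subset _ _).trans h₂)
        (by rw [Finset.card_erase_of_mem hP₀]; have := Finset.card_pos.mpr ⟨P₀, hP₀⟩; lia)
      have hdeg := card_segRel_le_crossings (P₀ := P₀) (ε := -η) (L := L) hr
        (hgen (- -η) (by simp)) h₁ (by simpa using hL1)
      have hsub : ((T₁ ×ˢ T₂).filter fun q => SegRel r q.1 q.2 ∧ q.2.2.2 ≠ q.1.2.2) ⊆
          ((T₁ ×ˢ (T₂.erase P₀)).filter fun q => SegRel r q.1 q.2 ∧ q.2.2.2 ≠ q.1.2.2) ∪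
          (T₁.filter fun P => SegRel r P₀ P ∧ P.2.2 ≠ P₀.2.2).image fun P => (P, P₀) := by
        rintro ⟨P, P'⟩ hq
        simp only [Finset.mem_filter, Finset.mem_product, Finset.mem_union, Finset.mem_image,
          Finset.mem_erase] at hq ⊢
        by_cases h : P' = P₀
        · subst h
          exact Or.inr ⟨P, ⟨hq.1.1, hq.2.1.symm, hq.2.2.symm⟩, rfl⟩
        · exact Or.inl ⟨⟨hq.1.1, h, hq.1.2⟩, hq.2⟩
      have h3 := (Finset.card_le_card hsub).trans (Finset.card_union_le _ _)
      have h4 := Finset.card_image_le (s := T₁.filter fun P => SegRel r P₀ P ∧ P.2.2 ≠ P₀.2.2)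
        (f := fun P => (P, P₀))
      rw [Nat.succ_mul]
      lia

open Classical in
/-- The number of pairs of segments of length `r` swapped by a reflection. -/
theorem card_segRel_le [Infinite K] {M : ℕ} (hA : PlanarBound A M) (hr : r ≠ 0)
    (h2 : (2 : K) ≠ 0)
    (hchar : ∀ j : ℕ, 0 < j → 8 * j ^ 2 ≤ (segments A r).card → (j : K) ≠ 0) :
    ((segments A r ×ˢ segments A r).filter fun q => SegRel r q.1 q.2).card ≤
      (segments A r).card * (2 * 10 ^ 7 * (2 * (segments A r).card).sqrt + 3 * M) := by
  obtain ⟨η, hgen⟩ := exists_generic h2 r (segments A r)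
  have h := card_segRel_prod_le hA hr hgen hchar _ _ _ subset_rfl subset_rfl rfl
  have hsame : ((segments A r ×ˢ segments A r).filter fun q =>
      SegRel r q.1 q.2 ∧ q.2.2.2 = q.1.2.2).card ≤ M * (segments A r).card := by
    refine Finset.card_le_mul_card_image_of_maps_to (f := Prod.fst)
      (fun q hq => (Finset.mem_product.mp (Finset.mem_filter.mp hq).1).1) M fun P hP => ?_
    refine (Finset.card_le_card_of_injOn (fun q => (q.2.1, q.2.2.1)) (fun q hq => ?_) ?_).trans
      (hA.2.1 (P.2.1 + r * P.2.2 ^ 2 * P.1) (-(r * P.2.2 ^ 2)))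
    · obtain ⟨⟨hq1, hq2, hq3⟩, rfl⟩ := by
        simpa only [Finset.coe_filter, Finset.mem_filter, Set.mem_ofPred_eq] using hq
      refine Finset.mem_coe.mpr (Finset.mem_filter.mpr
        ⟨((mem_segments hr).mp (Finset.mem_product.mp hq1).2).2.1, ?_⟩)
      rw [SegRel, hq3] at hq2
      simp only
      linear_combination -hq2
    · rintro q hq q' hq' heq
      simp only [Finset.coe_filter, Finset.mem_filter, Set.mem_ofPred_eq] at hq hq'
      simp only [Prod.mk.injEq] at heq
      have e1 : q.1 = q'.1 := hq.2.trans hq'.2.symm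
      exact Prod.ext e1 (Prod.ext heq.1 (Prod.ext heq.2
        (hq.1.2.2.trans ((congrArg (fun P => P.2.2) e1).trans hq'.1.2.2.symm))))
  have hsub : ((segments A r ×ˢ segments A r).filter fun q => SegRel r q.1 q.2) ⊆
      ((segments A r ×ˢ segments A r).filter fun q => SegRel r q.1 q.2 ∧ q.2.2.2 ≠ q.1.2.2) ∪
      ((segments A r ×ˢ segments A r).filter fun q => SegRel r q.1 q.2 ∧ q.2.2.2 = q.1.2.2) := by
    intro q hq
    simp only [Finset.mem_union, Finset.mem_filter] at hq ⊢
    tauto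
  refine (Finset.card_le_card hsub).trans ((Finset.card_union_le _ _).trans ?_)
  refine (add_le_add h hsame).trans (le_of_eq ?_)
  ring

end Incidences
section Planar

variable {K : Type*} [Field K]

theorem card_le_two_of_quadratic {α : Type*} {s : Finset α} {g : α → K} (hg : Set.InjOn g s)
    {a b c : K} (ha : a ≠ 0) (h : ∀ x ∈ s, a * g x ^ 2 + b * g x + c = 0) : s.card ≤ 2 := by
  by_contra! hs
  obtain ⟨x, y, z, hx, hy, hz, hxy, hxz, hyz⟩ := Finset.two_lt_card_iff.mp hs
  have h1 : g x - g y ≠ 0 := sub_ne_zero.mpr fun h0 => hxy (hg hx hy h0)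
  have h2 : g x - g z ≠ 0 := sub_ne_zero.mpr fun h0 => hxz (hg hx hz h0)
  have h3 : g y - g z ≠ 0 := sub_ne_zero.mpr fun h0 => hyz (hg hy hz h0)
  have e1 : a * (g x + g y) + b = 0 := by
    apply (mul_eq_zero.mp _).resolve_left h1
    linear_combination h x hx - h y hy
  have e2 : a * (g x + g z) + b = 0 := by
    apply (mul_eq_zero.mp _).resolve_left h2
    linear_combination h x hx - h z hz
  exact mul_ne_zero ha h3 (by linear_combination e1 - e2)

variable {A : Finset (K × K)} {D : ℕ}

open Classical in
theorem card_fst_eq_le (hD : ∀ x ∈ A, (A.image fun a => isoDist a x).card ≤ D)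
    (h1 : ¬ ∃ x, ∀ a ∈ A, a.1 = x) (x : K) : (A.filter fun a => a.1 = x).card ≤ D := by
  push Not at h1
  obtain ⟨p, hp, hpx⟩ := h1 x
  refine (Finset.card_le_card_of_injOn (fun a => isoDist a p) (fun a ha => ?_) ?_).trans (hD p hp)
  · exact Finset.mem_coe.mpr (Finset.mem_image_of_mem _ (Finset.mem_filter.mp ha).1)
  · intro a ha b hb hab
    have ha1 := (Finset.mem_filter.mp (Finset.mem_coe.mp ha)).2
    have hb1 := (Finset.mem_filter.mp (Finset.mem_coe.mp hb)).2
    simp only [isoDist, ha1, hb1] at hab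
    exact Prod.ext (ha1.trans hb1.symm)
      (sub_left_injective (mul_left_cancel₀ (sub_ne_zero.mpr hpx.symm) hab))

open Classical in
theorem card_snd_eq_le (hD : ∀ x ∈ A, (A.image fun a => isoDist a x).card ≤ D)
    (h2 : ¬ ∃ y, ∀ a ∈ A, a.2 = y) (y : K) : (A.filter fun a => a.2 = y).card ≤ D := by
  push Not at h2
  obtain ⟨p, hp, hpy⟩ := h2 y
  refine (Finset.card_le_card_of_injOn (fun a => isoDist a p) (fun a ha => ?_) ?_).trans (hD p hp)
  · exact Finset.mem_coe.mpr (Finset.mem_image_of_mem _ (Finset.mem_filter.mp ha).1)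
  · intro a ha b hb hab
    have ha2 := (Finset.mem_filter.mp (Finset.mem_coe.mp ha)).2
    have hb2 := (Finset.mem_filter.mp (Finset.mem_coe.mp hb)).2
    simp only [isoDist, ha2, hb2] at hab
    exact Prod.ext (sub_left_injective (mul_right_cancel₀ (sub_ne_zero.mpr hpy.symm) hab))
      (ha2.trans hb2.symm)

open Classical in
/-- A set whose points see few distances from one of its points has few points. -/
theorem card_le_two_mul_of_fibers (hD : ∀ x ∈ A, (A.image fun a => isoDist a x).card ≤ D)
    {s : Finset (K × K)} (hs : s ⊆ A)
    (h : ∀ p ∈ s, ∀ ρ, (s.filter fun a => isoDist a p = ρ).card ≤ 2) : s.card ≤ 2 * D := by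
  rcases s.eq_empty_or_nonempty with rfl | ⟨p, hp⟩
  · simp
  refine (Finset.card_le_mul_card_image (f := fun a => isoDist a p) s 2 fun ρ _ => h p hp ρ).trans
    (Nat.mul_le_mul_left 2 ?_)
  exact (Finset.card_le_card (Finset.image_subset_image hs)).trans (hD p (hs hp))

open Classical in
theorem planarBound (hD : ∀ x ∈ A, (A.image fun a => isoDist a x).card ≤ D)
    (h1 : ¬ ∃ x, ∀ a ∈ A, a.1 = x) (h2 : ¬ ∃ y, ∀ a ∈ A, a.2 = y) : PlanarBound A (2 * D) := by
  refine ⟨fun x => (card_fst_eq_le hD h1 x).trans (by lia), fun α β => ?_, fun x y ρ hρ => ?_⟩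
  · by_cases hβ : β = 0
    · subst hβ
      simpa using (card_snd_eq_le hD h2 α).trans (by lia)
    refine card_le_two_mul_of_fibers hD (Finset.filter_subset _ _) fun p hp τ => ?_
    have hp' := (Finset.mem_filter.mp hp).2
    refine card_le_two_of_quadratic (g := Prod.fst) (a := β) (b := -(2 * β * p.1))
      (c := β * p.1 ^ 2 - τ) ?_ hβ ?_
    · intro a ha b hb hab
      simp only [Finset.coe_filter, Finset.mem_filter, Set.mem_ofPred_eq] at ha hb
      exact Prod.ext hab (by rw [ha.1.2, hb.1.2, hab])
    · intro a ha
      simp only [Finset.mem_filter] at ha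
      rw [← ha.2, isoDist, ha.1.2, hp']
      ring
  · refine card_le_two_mul_of_fibers hD (Finset.filter_subset _ _) fun p hp τ => ?_
    have hp' := (Finset.mem_filter.mp hp).2
    have hy : p.2 - y ≠ 0 := fun h0 => hρ (by rw [← hp', h0, mul_zero])
    refine card_le_two_of_quadratic (g := fun a => a.1 - x) (a := p.2 - y) (b := τ - 2 * ρ)
      (c := (p.1 - x) * ρ) ?_ hy ?_
    · intro a ha b hb hab
      simp only [Finset.coe_filter, Finset.mem_filter, Set.mem_ofPred_eq] at ha hb hab
      have hx : a.1 - x ≠ 0 := fun h0 => hρ (by rw [← ha.1.2, h0, zero_mul])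
      have hb' := hb.1.2
      rw [← hab, ← ha.1.2] at hb'
      exact Prod.ext (sub_left_injective hab) (sub_left_injective (mul_left_cancel₀ hx hb').symm)
    · intro a ha
      simp only [Finset.mem_filter] at ha
      rw [← ha.2, isoDist]
      linear_combination (a.1 - p.1) * ha.1.2 + (a.1 - x) * hp'

open Classical in
theorem card_circle_inter_le {r : K} (hr : r ≠ 0) {b b' : K × K} (hb : b ≠ b') :
    (A.filter fun c => isoDist c b = r ∧ isoDist c b' = r).card ≤ 2 := by
  have hlin : ∀ c ∈ A.filter fun c => isoDist c b = r ∧ isoDist c b' = r,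
      (c.1 - b.1) * (b'.2 - b.2) + (b'.1 - b.1) * (c.2 - b'.2) = 0 := by
    intro c hc
    obtain ⟨-, h1, h2⟩ := Finset.mem_filter.mp hc
    simp only [isoDist] at h1 h2
    linear_combination h1 - h2
  by_cases h1 : b'.1 = b.1
  · have h2 : b'.2 - b.2 ≠ 0 := sub_ne_zero.mpr fun h0 => hb (Prod.ext h1.symm h0.symm)
    refine le_of_eq_of_le (Finset.card_eq_zero.mpr (Finset.eq_empty_of_forall_notMem
      fun c hc => hr ?_)) zero_le_two
    have h3 := hlin c hc
    rw [h1, sub_self, zero_mul, add_zero] at h3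
    rw [← (Finset.mem_filter.mp hc).2.1, isoDist, (mul_eq_zero.mp h3).resolve_right h2, zero_mul]
  have h1' := sub_ne_zero.mpr h1
  by_cases h2 : b'.2 = b.2
  · refine le_of_eq_of_le (Finset.card_eq_zero.mpr (Finset.eq_empty_of_forall_notMem
      fun c hc => hr ?_)) zero_le_two
    have h3 := hlin c hc
    rw [h2, sub_self, mul_zero, zero_add] at h3
    rw [← (Finset.mem_filter.mp hc).2.1, isoDist, (mul_eq_zero.mp h3).resolve_left h1', mul_zero]
  refine card_le_two_of_quadratic (g := fun c => c.1 - b.1) (a := b'.2 - b.2)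
    (b := -((b'.2 - b.2) * (b'.1 - b.1))) (c := r * (b'.1 - b.1)) ?_ (sub_ne_zero.mpr h2) ?_
  · intro c hc d hd hcd
    have e1 := hlin c hc
    have e2 := hlin d hd
    simp only at hcd
    rw [hcd] at e1
    have e3 : c.2 - b'.2 = d.2 - b'.2 := mul_left_cancel₀ h1' (by linear_combination e1 - e2)
    exact Prod.ext (sub_left_injective hcd) (sub_left_injective e3)
  · intro c hc
    have e1 := hlin c hc
    have e2 := (Finset.mem_filter.mp hc).2.1
    rw [isoDist] at e2
    linear_combination (c.1 - b.1) * e1 - (b'.1 - b.1) * e2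

open Classical in
/-- The number of unit distances, from the absence of `K_{2,3}`. -/
theorem card_segments_sq_le {r : K} (hr : r ≠ 0) :
    (segments A r).card ^ 2 ≤ 3 * A.card ^ 3 := by
  rw [card_segments hr]
  set S := (A ×ˢ A).filter fun b => isoDist b.2 b.1 = r with hS
  have hScard : S.card ≤ A.card * A.card :=
    (Finset.card_filter_le _ _).trans (Finset.card_product _ _).le
  have h1 : S.card = ∑ c ∈ A, (A.filter fun b => isoDist c b = r).card := by
    rw [hS, Finset.card_filter, Finset.sum_product_right]
    exact Finset.sum_congr rfl fun c _ => (Finset.card_filter _ _).symm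
  have h2 : ∑ c ∈ A, (A.filter fun b => isoDist c b = r).card ^ 2 ≤
      S.card + 2 * (A.card * A.card) := by
    have e1 : ∀ c, (A.filter fun b => isoDist c b = r).card ^ 2 =
        ∑ q ∈ A ×ˢ A, if isoDist c q.1 = r ∧ isoDist c q.2 = r then 1 else 0 := by
      intro c
      rw [sq, ← Finset.card_product, ← Finset.card_filter, ← Finset.filter_product]
    simp_rw [e1]
    rw [Finset.sum_comm]
    simp_rw [← Finset.card_filter]
    have e2 : ∀ q ∈ A ×ˢ A, (A.filter fun c => isoDist c q.1 = r ∧ isoDist c q.2 = r).card ≤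
        2 + if q.1 = q.2 then (A.filter fun c => isoDist c q.1 = r).card else 0 := by
      intro q _
      by_cases hq : q.1 = q.2
      · rw [if_pos hq, ← hq]
        simp
      · rw [if_neg hq]
        exact card_circle_inter_le hr hq
    refine (Finset.sum_le_sum e2).trans (le_of_eq ?_)
    rw [Finset.sum_add_distrib, Finset.sum_const, Finset.card_product, smul_eq_mul, add_comm,
      mul_comm _ 2, Finset.sum_product]
    simp only [Finset.sum_ite_eq, Finset.sum_ite_mem, Finset.inter_self]
    congr 1
    rw [hS, Finset.card_filter, Finset.sum_product]
    exact Finset.sum_congr rfl fun c _ => Finset.card_filter _ _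
  have h3 := sq_sum_le_card_mul_sum_sq (s := A)
    (f := fun c => (A.filter fun b => isoDist c b = r).card)
  rw [← h1, Nat.cast_id] at h3
  refine h3.trans ((Nat.mul_le_mul_left _ (h2.trans (Nat.add_le_add_right hScard _))).trans
    (le_of_eq ?_))
  ring

end Planar
section Counting

open Classical in
theorem card_collisions {α β : Type*} {s : Finset α} {t : Finset β} {f : α → β}
    (h : ∀ x ∈ s, f x ∈ t) : ((s ×ˢ s).filter fun q => f q.1 = f q.2).card =
      ∑ b ∈ t, (s.filter fun x => f x = b).card ^ 2 := by
  rw [Finset.card_eq_sum_card_fiberwise (f := fun q => f q.1) (t := t)]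
  · refine Finset.sum_congr rfl fun b _ => ?_
    rw [sq, ← Finset.card_product]
    congr 1
    ext q
    simp only [Finset.mem_filter, Finset.mem_product]
    constructor
    · rintro ⟨⟨h1, h2⟩, rfl⟩
      exact ⟨⟨h1.1, rfl⟩, h1.2, h2.symm⟩
    · rintro ⟨⟨h1, rfl⟩, h2, h3⟩
      exact ⟨⟨⟨h1, h2⟩, h3.symm⟩, rfl⟩
  · intro q hq
    exact h _ (Finset.mem_product.mp (Finset.mem_filter.mp hq).1).1

open Classical in
theorem card_sq_le_collisions {α β : Type*} (s : Finset α) (f : α → β) :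
    s.card ^ 2 ≤ (s.image f).card * ((s ×ˢ s).filter fun q => f q.1 = f q.2).card := by
  rw [card_collisions fun x hx => Finset.mem_image_of_mem f hx]
  conv_lhs => rw [Finset.card_eq_sum_card_image f s]
  simpa using sq_sum_le_card_mul_sum_sq (s := s.image f) (f := fun b => (s.filter (f · = b)).card)

open Classical in
/-- Cauchy-Schwarz for incidences between points and lines with multiplicities. -/
theorem exists_incidence_bound {α β κ : Type*} (A : Finset α) (B : Finset β) (key : β → κ)
    (on : κ → α → Prop) (h : ∀ a ∈ A, ∀ a' ∈ A, a ≠ a' → ∀ k k', on k a → on k a' → on k' a →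
      on k' a' → k = k') :
    ∃ W : ℕ, ((A ×ˢ B).filter fun q => on (key q.2) q.1).card ≤ B.card + W ∧
      W ^ 2 ≤ ((B ×ˢ B).filter fun q => key q.1 = key q.2).card * A.card ^ 2 := by
  set t := B.image key with ht
  have hkey : ∀ b ∈ B, key b ∈ t := fun b hb => Finset.mem_image_of_mem _ hb
  set m : κ → ℕ := fun k => (B.filter fun b => key b = k).card with hm
  set i : κ → ℕ := fun k => (A.filter fun a => on k a).card with hi
  refine ⟨∑ k ∈ t, m k * (i k - 1), ?_, ?_⟩
  · have e1 : ((A ×ˢ B).filter fun q => on (key q.2) q.1).card = ∑ k ∈ t, m k * i k := by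
      rw [Finset.card_eq_sum_card_fiberwise (f := fun q => key q.2) (t := t)]
      · refine Finset.sum_congr rfl fun k _ => ?_
        rw [mul_comm, hm, hi, ← Finset.card_product]
        congr 1
        ext q
        simp only [Finset.mem_filter, Finset.mem_product]
        constructor
        · rintro ⟨⟨h1, h2⟩, rfl⟩
          exact ⟨⟨h1.1, h2⟩, h1.2, rfl⟩
        · rintro ⟨⟨h1, h2⟩, h3, rfl⟩
          exact ⟨⟨⟨h1, h3⟩, h2⟩, rfl⟩
      · intro q hq
        exact hkey _ (Finset.mem_product.mp (Finset.mem_filter.mp hq).1).2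
    have e2 : B.card = ∑ k ∈ t, m k :=
      Finset.card_eq_sum_card_fiberwise fun b hb => hkey b hb
    rw [e1, e2, ← Finset.sum_add_distrib]
    refine Finset.sum_le_sum fun k _ => ?_
    calc m k * i k ≤ m k * (1 + (i k - 1)) := Nat.mul_le_mul_left _ (by lia)
      _ = m k + m k * (i k - 1) := by ring
  · refine (Finset.sum_mul_sq_le_sq_mul_sq _ _ _).trans ?_
    rw [card_collisions hkey]
    refine Nat.mul_le_mul_left _ ?_
    have e1 : ∀ k, (i k - 1) ^ 2 ≤ (A.offDiag.filter fun q => on k q.1 ∧ on k q.2).card := by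
      intro k
      have e2 : (A.filter fun a => on k a).offDiag ⊆
          A.offDiag.filter fun q => on k q.1 ∧ on k q.2 := by
        intro q hq
        simp only [Finset.mem_offDiag, Finset.mem_filter] at hq ⊢
        tauto
      refine le_trans ?_ (Finset.card_le_card e2)
      rw [Finset.offDiag_card, ← Nat.mul_sub_one]
      change (i k - 1) ^ 2 ≤ i k * (i k - 1)
      rw [sq]
      exact Nat.mul_le_mul_right _ (Nat.sub_le _ _)
    refine (Finset.sum_le_sum fun k _ => e1 k).trans ?_
    simp_rw [Finset.card_filter]
    rw [Finset.sum_comm]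
    simp_rw [← Finset.card_filter]
    have e3 : ∀ q ∈ A.offDiag, (t.filter fun k => on k q.1 ∧ on k q.2).card ≤ 1 := by
      intro q hq
      obtain ⟨h1, h2, h3⟩ := Finset.mem_offDiag.mp hq
      refine Finset.card_le_one.mpr fun k hk k' hk' => ?_
      simp only [Finset.mem_filter] at hk hk'
      exact h _ h1 _ h2 h3 k k' hk.2.1 hk.2.2 hk'.2.1 hk'.2.2
    refine (Finset.sum_le_sum e3).trans ?_
    rw [Finset.sum_const, smul_eq_mul, mul_one, Finset.offDiag_card, sq]
    exact Nat.sub_le _ _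

variable {K : Type*} [Field K] {A : Finset (K × K)} {D : ℕ}

open Classical in
/-- Isosceles triangles `(a, b, c)` with apex `a` and legs of nonzero length. -/
noncomputable def isosceles (A : Finset (K × K)) : Finset ((K × K) × (K × K) × (K × K)) :=
  (A ×ˢ (A ×ˢ A)).filter fun q => isoDist q.2.1 q.1 = isoDist q.2.2 q.1 ∧ isoDist q.2.1 q.1 ≠ 0

open Classical in
theorem card_isosceles : (isosceles A).card = ∑ a ∈ A,
    (((A.filter fun b => isoDist b a ≠ 0) ×ˢ (A.filter fun b => isoDist b a ≠ 0)).filter fun q =>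
      isoDist q.1 a = isoDist q.2 a).card := by
  rw [isosceles, Finset.card_filter, Finset.sum_product]
  refine Finset.sum_congr rfl fun a _ => ?_
  rw [← Finset.card_filter]
  congr 1
  ext q
  simp only [Finset.mem_filter, Finset.mem_product]
  constructor
  · rintro ⟨⟨h1, h2⟩, h3, h4⟩
    exact ⟨⟨⟨h1, h4⟩, h2, h3 ▸ h4⟩, h3⟩
  · rintro ⟨⟨⟨h1, h4⟩, h2, -⟩, h3⟩
    exact ⟨⟨h1, h2⟩, h3, h4⟩

open Classical in
theorem card_isoDist_eq_zero_le (h1 : ∀ x, (A.filter fun a => a.1 = x).card ≤ D)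
    (h2 : ∀ y, (A.filter fun a => a.2 = y).card ≤ D) (b : K × K) :
    (A.filter fun a => isoDist a b = 0).card ≤ 2 * D := by
  have : (A.filter fun a => isoDist a b = 0) ⊆
      (A.filter fun a => a.1 = b.1) ∪ A.filter fun a => a.2 = b.2 := by
    intro a ha
    simp only [Finset.mem_filter, Finset.mem_union, isoDist, mul_eq_zero, sub_eq_zero] at ha ⊢
    tauto
  refine (Finset.card_le_card this).trans ((Finset.card_union_le _ _).trans ?_)
  have := h1 b.1
  have := h2 b.2
  lia

open Classical in
theorem card_pow_three_le_isosceles (hD : ∀ x ∈ A, (A.image fun a => isoDist a x).card ≤ D)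
    (h0 : ∀ b, (A.filter fun a => isoDist a b = 0).card ≤ 2 * D) (hn : 4 * D ≤ A.card) :
    A.card ^ 3 ≤ 4 * D * (isosceles A).card := by
  rw [card_isosceles, Finset.mul_sum, pow_succ', ← smul_eq_mul, ← Finset.sum_const]
  refine Finset.sum_le_sum fun a ha => ?_
  set S := A.filter fun b => isoDist b a ≠ 0 with hS
  have e1 : A.card ≤ 2 * S.card := by
    have := Finset.card_filter_add_card_filter_not (s := A) fun b => isoDist b a = 0
    have := h0 a
    lia
  have e2 := card_sq_le_collisions S fun b => isoDist b a
  have e3 : (S.image fun b => isoDist b a).card ≤ D :=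
    (Finset.card_le_card (Finset.image_subset_image (Finset.filter_subset _ _))).trans (hD a ha)
  calc A.card ^ 2 ≤ (2 * S.card) ^ 2 := Nat.pow_le_pow_left e1 2
    _ = 4 * S.card ^ 2 := by ring
    _ ≤ 4 * (D * _) := Nat.mul_le_mul_left 4 (e2.trans (Nat.mul_le_mul_right _ e3))
    _ = _ := by ring

open Classical in
/-- The nonzero distances of `A`. -/
noncomputable def distances (A : Finset (K × K)) : Finset K :=
  ((A ×ˢ A).image fun b => isoDist b.2 b.1).erase 0

open Classical in
theorem sum_card_segments_le : ∑ r ∈ distances A, (segments A r).card ≤ A.card ^ 2 := by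
  rw [Finset.sum_congr rfl fun r (hr : r ∈ distances A) =>
    card_segments (Finset.ne_of_mem_erase hr), sq,
    ← Finset.card_product]
  refine le_trans (Finset.sum_le_sum_of_subset (Finset.erase_subset _ _)) ?_
  rw [← Finset.card_eq_sum_card_image]

open Classical in
theorem sum_card_segments_sq_le :
    ∑ r ∈ distances A, (segments A r).card ^ 2 ≤ A.card * (isosceles A).card := by
  have e1 : ∀ r ∈ distances A, (segments A r).card ^ 2 ≤
      A.card * ∑ a ∈ A, (A.filter fun b => isoDist b a = r).card ^ 2 := by
    intro r hr
    rw [card_segments (Finset.ne_of_mem_erase hr), Finset.card_filter, Finset.sum_product]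
    simp_rw [← Finset.card_filter]
    simpa using sq_sum_le_card_mul_sum_sq (s := A)
      (f := fun a => (A.filter fun b => isoDist b a = r).card)
  refine (Finset.sum_le_sum e1).trans ?_
  rw [← Finset.mul_sum, Finset.sum_comm, card_isosceles]
  refine Nat.mul_le_mul_left _ (Finset.sum_le_sum fun a ha => ?_)
  rw [card_collisions (t := distances A) (f := fun b => isoDist b a)]
  · refine Finset.sum_le_sum fun r hr => Nat.pow_le_pow_left (Finset.card_le_card fun b hb => ?_) 2
    simp only [Finset.mem_filter] at hb ⊢
    exact ⟨⟨hb.1, hb.2 ▸ Finset.ne_of_mem_erase hr⟩, hb.2⟩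
  · intro b hb
    obtain ⟨hb, hne⟩ := Finset.mem_filter.mp hb
    exact Finset.mem_erase.mpr ⟨hne, Finset.mem_image.mpr
      ⟨(a, b), Finset.mem_product.mpr ⟨ha, hb⟩, rfl⟩⟩

/-- Slope and offset of the bisector of two points. -/
def bisector (b : (K × K) × (K × K)) : K × K :=
  ((b.1.2 - b.2.2) / (b.1.1 - b.2.1), b.1.2 + (b.1.2 - b.2.2) / (b.1.1 - b.2.1) * b.2.1)

open Classical in
/-- The pairs of points of `A` at nonzero distance. -/
noncomputable def anisotropicPairs (A : Finset (K × K)) : Finset ((K × K) × (K × K)) :=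
  (A ×ˢ A).filter fun b => isoDist b.1 b.2 ≠ 0

open Classical in
/-- Pairs of pairs of points with the same bisector. -/
noncomputable def sameBisector (A : Finset (K × K)) :
    Finset (((K × K) × (K × K)) × ((K × K) × (K × K))) :=
  (anisotropicPairs A ×ˢ anisotropicPairs A).filter fun q => bisector q.1 = bisector q.2

theorem isoDist_ne_zero_iff {b c : K × K} : isoDist b c ≠ 0 ↔ b.1 - c.1 ≠ 0 ∧ b.2 - c.2 ≠ 0 :=
  mul_ne_zero_iff

open Classical in
theorem exists_card_isosceles_le : ∃ W : ℕ, (isosceles A).card ≤ 2 * A.card ^ 2 + W ∧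
    W ^ 2 ≤ (sameBisector A).card * A.card ^ 2 := by
  obtain ⟨W, hW, hW2⟩ := exists_incidence_bound A (anisotropicPairs A) bisector
    (fun k a => a.2 + k.1 * a.1 = k.2) (by
      rintro ⟨a1, a2⟩ - ⟨a1', a2'⟩ - hne ⟨k1, k2⟩ ⟨k1', k2'⟩ h1 h2 h3 h4
      simp only at h1 h2 h3 h4
      have h5 : a1 - a1' ≠ 0 := by
        intro h0
        apply hne
        have : a1 = a1' := sub_eq_zero.mp h0
        subst this
        exact Prod.ext rfl (by linear_combination h1 - h2)
      have h6 : k1 = k1' := mul_right_cancel₀ h5 (by linear_combination h1 - h2 - h3 + h4)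
      subst h6
      exact Prod.ext rfl (h1.symm.trans h3))
  refine ⟨W, ?_, by rw [sameBisector]; convert hW2⟩
  have hB : (anisotropicPairs A).card ≤ A.card ^ 2 :=
    (Finset.card_filter_le _ _).trans (by rw [Finset.card_product, sq])
  have hdiag : ((isosceles A).filter fun q => q.2.1 = q.2.2).card ≤ A.card ^ 2 := by
    rw [sq, ← Finset.card_product]
    refine Finset.card_le_card_of_injOn (fun q => (q.1, q.2.1)) (fun q hq => ?_) ?_
    · simp only [isosceles, Finset.coe_filter, Finset.mem_filter, Finset.mem_product,
        Set.mem_ofPred_eq] at hq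
      exact Finset.mem_coe.mpr (Finset.mem_product.mpr ⟨hq.1.1.1, hq.1.1.2.1⟩)
    · intro q hq q' hq' h
      have e1 := (Finset.mem_filter.mp (Finset.mem_coe.mp hq)).2
      have e2 := (Finset.mem_filter.mp (Finset.mem_coe.mp hq')).2
      simp only [Prod.mk.injEq] at h
      exact Prod.ext h.1 (Prod.ext h.2 (e1.symm.trans (h.2.trans e2)))
  have hrest : ((isosceles A).filter fun q => ¬ q.2.1 = q.2.2) ⊆
      (A ×ˢ anisotropicPairs A).filter fun q => q.1.2 + (bisector q.2).1 * q.1.1 =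
        (bisector q.2).2 := by
    rintro ⟨a, b, c⟩ hq
    simp only [isosceles, Finset.mem_filter, Finset.mem_product] at hq
    obtain ⟨⟨⟨ha, hb, hc⟩, heq, h0⟩, hne⟩ := hq
    rw [isoDist_ne_zero_iff] at h0
    simp only [isoDist] at heq
    have h1 : b.1 - c.1 ≠ 0 := by
      intro h
      apply hne
      have h' := sub_eq_zero.mp h
      rw [← h'] at heq
      exact Prod.ext h' (sub_left_injective (mul_left_cancel₀ h0.1 heq))
    have h2 : b.2 - c.2 ≠ 0 := by
      intro h
      apply hne
      have h' := sub_eq_zero.mp h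
      rw [← h'] at heq
      exact Prod.ext (sub_left_injective (mul_right_cancel₀ h0.2 heq)) h'
    refine Finset.mem_filter.mpr ⟨Finset.mem_product.mpr ⟨ha, Finset.mem_filter.mpr
      ⟨Finset.mem_product.mpr ⟨hb, hc⟩, isoDist_ne_zero_iff.mpr ⟨h1, h2⟩⟩⟩, ?_⟩
    simp only [bisector]
    field_simp
    linear_combination -heq
  have e1 := Finset.card_filter_add_card_filter_not (s := isosceles A) fun q => q.2.1 = q.2.2
  have e2 := (Finset.card_le_card hrest).trans hW
  lia

/-- The bisector determines the reflection. -/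
theorem eq_reflection {b : (K × K) × (K × K)} (hb : isoDist b.1 b.2 ≠ 0) :
    (bisector b).1 ≠ 0 ∧ b.2.1 = ((bisector b).2 - b.1.2) / (bisector b).1 ∧
      b.2.2 = (bisector b).2 - (bisector b).1 * b.1.1 := by
  obtain ⟨h1, h2⟩ := isoDist_ne_zero_iff.mp hb
  have h3 : (bisector b).1 ≠ 0 := div_ne_zero h2 h1
  refine ⟨h3, ?_, ?_⟩
  · rw [eq_div_iff h3]
    simp only [bisector]
    ring
  · simp only [bisector]
    field_simp
    ring

open Classical in
theorem card_sameBisector_le (h0 : ∀ b, (A.filter fun a => isoDist a b = 0).card ≤ 2 * D) :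
    (sameBisector A).card ≤ 2 * D * A.card ^ 2 + ∑ r ∈ distances A,
      ((segments A r ×ˢ segments A r).filter fun q => SegRel r q.1 q.2).card := by
  have hmem : ∀ q ∈ sameBisector A, (q.1.1 ∈ A ∧ q.1.2 ∈ A) ∧ (q.2.1 ∈ A ∧ q.2.2 ∈ A) ∧
      isoDist q.1.1 q.1.2 ≠ 0 ∧ isoDist q.2.1 q.2.2 ≠ 0 ∧ bisector q.1 = bisector q.2 := by
    intro q hq
    simp only [sameBisector, anisotropicPairs, Finset.mem_filter, Finset.mem_product] at hq
    tauto
  have hzero : ((sameBisector A).filter fun q => isoDist q.2.1 q.1.1 = 0).card ≤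
      2 * D * A.card ^ 2 := by
    rw [sq, ← Finset.card_product]
    refine Finset.card_le_mul_card_image_of_maps_to (f := Prod.fst) (fun q hq => ?_) _
      fun b hb => ?_
    · exact Finset.mem_product.mpr (hmem q (Finset.mem_filter.mp hq).1).1
    · refine (Finset.card_le_card_of_injOn (fun q => q.2.1) (fun q hq => ?_) ?_).trans (h0 b.1)
      · obtain ⟨hq', rfl⟩ := Finset.mem_filter.mp hq
        obtain ⟨hq', h⟩ := Finset.mem_filter.mp hq'
        exact Finset.mem_coe.mpr (Finset.mem_filter.mpr ⟨(hmem q hq').2.1.1, h⟩)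
      · intro q hq q' hq' h
        obtain ⟨hq, hqb⟩ := Finset.mem_filter.mp (Finset.mem_coe.mp hq)
        obtain ⟨hq', hqb'⟩ := Finset.mem_filter.mp (Finset.mem_coe.mp hq')
        obtain ⟨-, -, -, h1, h2⟩ := hmem q (Finset.mem_filter.mp hq).1
        obtain ⟨-, -, -, h1', h2'⟩ := hmem q' (Finset.mem_filter.mp hq').1
        simp only at h
        have h3 : bisector q.2 = bisector q'.2 := by rw [← h2, ← h2', hqb, hqb']
        obtain ⟨-, e1, e2⟩ := eq_reflection h1
        obtain ⟨-, e1', e2'⟩ := eq_reflection h1'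
        rw [h3, h] at e1 e2
        exact Prod.ext (hqb.trans hqb'.symm)
          (Prod.ext h (Prod.ext (e1.trans e1'.symm) (e2.trans e2'.symm)))
  have hne : ((sameBisector A).filter fun q => ¬ isoDist q.2.1 q.1.1 = 0).card ≤
      ∑ r ∈ distances A,
        ((segments A r ×ˢ segments A r).filter fun q => SegRel r q.1 q.2).card := by
    rw [Finset.card_eq_sum_card_fiberwise (f := fun q => isoDist q.2.1 q.1.1) (t := distances A)]
    · refine Finset.sum_le_sum fun r hr => ?_
      have hr0 : r ≠ 0 := Finset.ne_of_mem_erase hr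
      have hgeom : ∀ q ∈ ((sameBisector A).filter fun q => ¬ isoDist q.2.1 q.1.1 = 0).filter
          fun q => isoDist q.2.1 q.1.1 = r, q ∈ sameBisector A ∧ isoDist q.2.1 q.1.1 = r ∧
          isoDist q.2.2 q.1.2 = r ∧ (bisector q.1).1 =
            (q.2.1.2 - q.1.1.2) * -(q.2.2.1 - q.1.2.1)⁻¹ := by
        intro q hq
        obtain ⟨hq, hqr⟩ := Finset.mem_filter.mp hq
        have hqB := (Finset.mem_filter.mp hq).1
        obtain ⟨-, -, h1, h2, h3⟩ := hmem q hqB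
        obtain ⟨hk, e1, e2⟩ := eq_reflection h1
        obtain ⟨-, e1', e2'⟩ := eq_reflection h2
        rw [← h3] at e1' e2'
        have h4 : isoDist q.2.2 q.1.2 = r := by
          rw [← hqr, isoDist, isoDist, e1, e1', e2, e2']
          field_simp
          ring
        refine ⟨hqB, hqr, h4, ?_⟩
        have h5 := (isoDist_ne_zero_iff.mp (h4.trans_ne hr0)).1
        rw [mul_neg, ← div_eq_mul_inv, ← neg_div, eq_div_iff h5, e1, e1']
        field_simp
        ring
      refine Finset.card_le_card_of_injOn (fun q =>
        ((q.1.1.1, q.1.1.2, (q.2.1.1 - q.1.1.1)⁻¹), (q.1.2.1, q.1.2.2, (q.2.2.1 - q.1.2.1)⁻¹)))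
        (fun q hq => ?_) fun q hq q' hq' h => ?_
      · obtain ⟨hqB, h1, h2, h3⟩ := hgeom q hq
        obtain ⟨⟨m1, m2⟩, ⟨m3, m4⟩, h4, -, -⟩ := hmem q hqB
        refine Finset.mem_coe.mpr (Finset.mem_filter.mpr ⟨Finset.mem_product.mpr ⟨?_, ?_⟩, ?_⟩)
        · exact Finset.mem_image.mpr
            ⟨(q.1.1, q.2.1), Finset.mem_filter.mpr ⟨Finset.mem_product.mpr ⟨m1, m3⟩, h1⟩, rfl⟩
        · exact Finset.mem_image.mpr
            ⟨(q.1.2, q.2.2), Finset.mem_filter.mpr ⟨Finset.mem_product.mpr ⟨m2, m4⟩, h2⟩, rfl⟩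
        · have h5 := (isoDist_ne_zero_iff.mp (h1.trans_ne hr0)).1
          have h6 : (q.1.1.2 - q.1.2.2) =
              (q.2.1.2 - q.1.1.2) * -(q.2.2.1 - q.1.2.1)⁻¹ * (q.1.1.1 - q.1.2.1) := by
            rw [← h3, bisector, div_mul_cancel₀ _ (isoDist_ne_zero_iff.mp h4).1]
          simp only [SegRel]
          rw [h6, ← h1, isoDist]
          field_simp
          ring
      · obtain ⟨hqB, h1, h2, -⟩ := hgeom q hq
        obtain ⟨hqB', h1', h2', -⟩ := hgeom q' hq'
        obtain ⟨⟨⟨b1, b2⟩, ⟨c1, c2⟩⟩, ⟨⟨d1, d2⟩, ⟨e1, e2⟩⟩⟩ := q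
        obtain ⟨⟨⟨b1', b2'⟩, ⟨c1', c2'⟩⟩, ⟨⟨d1', d2'⟩, ⟨e1', e2'⟩⟩⟩ := q'
        simp only [Prod.mk.injEq, inv_inj, isoDist] at h h1 h2 h1' h2' ⊢
        obtain ⟨⟨rfl, rfl, h3⟩, ⟨rfl, rfl, h4⟩⟩ := h
        have h5 : d1 = d1' := sub_left_injective h3
        have h6 : e1 = e1' := sub_left_injective h4
        subst h5 h6
        have h7 : d1 - b1 ≠ 0 := fun h0 => hr0 (by rw [← h1, h0, zero_mul])
        have h8 : e1 - c1 ≠ 0 := fun h0 => hr0 (by rw [← h2, h0, zero_mul])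
        exact ⟨⟨⟨rfl, rfl⟩, rfl, rfl⟩,
          ⟨rfl, sub_left_injective (mul_left_cancel₀ h7 (h1.trans h1'.symm))⟩,
          rfl, sub_left_injective (mul_left_cancel₀ h8 (h2.trans h2'.symm))⟩
    · intro q hq
      obtain ⟨hq, h⟩ := Finset.mem_filter.mp hq
      obtain ⟨m1, m2, -⟩ := hmem q hq
      exact Finset.mem_erase.mpr ⟨h, Finset.mem_image.mpr
        ⟨(q.1.1, q.2.1), Finset.mem_product.mpr ⟨m1.1, m2.1⟩, rfl⟩⟩
  rw [← Finset.card_filter_add_card_filter_not fun q => isoDist q.2.1 q.1.1 = 0]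
  exact add_le_add hzero hne

end Counting
section Conclusion

theorem sq_le_pow_three_of_inequalities {n D T W Q V : ℝ} (hn : 0 < n) (hD : 1 ≤ D)
    (h1 : n ^ 3 ≤ 4 * D * T) (h2 : T ≤ 2 * n ^ 2 + W)
    (h3 : W ^ 2 ≤ Q * n ^ 2) (h4 : Q ≤ 8 * D * n ^ 2 + 2 * 10 ^ 7 * V)
    (h5 : V ^ 2 ≤ 2 * n ^ 3 * T) : n ^ 2 ≤ 4 * 10 ^ 18 * D ^ 3 := by
  have hD3 : D ^ 2 ≤ D ^ 3 := pow_le_pow_right₀ hD (by norm_num)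
  by_cases hTn : T ≤ 4 * n ^ 2
  · have e1 : n ≤ 16 * D := by
      refine le_of_mul_le_mul_right ?_ (pow_pos hn 2)
      calc n * n ^ 2 = n ^ 3 := by ring
        _ ≤ 4 * D * T := h1
        _ ≤ 4 * D * (4 * n ^ 2) := by gcongr
        _ = 16 * D * n ^ 2 := by ring
    calc n ^ 2 ≤ (16 * D) ^ 2 := by gcongr
      _ = 256 * D ^ 2 := by ring
      _ ≤ 4 * 10 ^ 18 * D ^ 3 := by nlinarith [sq_nonneg D]
  push Not at hTn
  have hT0 : 0 < T := by nlinarith [pow_pos hn 2]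
  have e1 : T ^ 2 ≤ 4 * n ^ 2 * Q :=
    calc T ^ 2 ≤ (2 * W) ^ 2 := by gcongr; linarith
      _ = 4 * W ^ 2 := by ring
      _ ≤ 4 * (Q * n ^ 2) := by gcongr
      _ = _ := by ring
  by_cases hVD : 2 * 10 ^ 7 * V ≤ 8 * D * n ^ 2
  · have e2 : n ^ 2 ≤ 1024 * D ^ 3 := by
      refine le_of_mul_le_mul_right ?_ (pow_pos hn 4)
      calc n ^ 2 * n ^ 4 = (n ^ 3) ^ 2 := by ring
        _ ≤ (4 * D * T) ^ 2 := by gcongr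
        _ = 16 * D ^ 2 * T ^ 2 := by ring
        _ ≤ 16 * D ^ 2 * (4 * n ^ 2 * (8 * D * n ^ 2 + 8 * D * n ^ 2)) := by
          gcongr
          exact e1.trans (by gcongr; linarith)
        _ = 1024 * D ^ 3 * n ^ 4 := by ring
    nlinarith [sq_nonneg D]
  push Not at hVD
  have e2 : T ^ 2 ≤ 16 * 10 ^ 7 * n ^ 2 * V :=
    calc T ^ 2 ≤ 4 * n ^ 2 * (2 * 10 ^ 7 * V + 2 * 10 ^ 7 * V) :=
          e1.trans (by gcongr; linarith)
      _ = _ := by ring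
  have e3 : T ^ 3 ≤ 512 * 10 ^ 14 * n ^ 7 := by
    refine le_of_mul_le_mul_right ?_ hT0
    calc T ^ 3 * T = (T ^ 2) ^ 2 := by ring
      _ ≤ (16 * 10 ^ 7 * n ^ 2 * V) ^ 2 := by gcongr
      _ = 256 * 10 ^ 14 * n ^ 4 * V ^ 2 := by ring
      _ ≤ 256 * 10 ^ 14 * n ^ 4 * (2 * n ^ 3 * T) := by gcongr
      _ = _ := by ring
  refine le_of_mul_le_mul_right ?_ (pow_pos hn 7)
  calc n ^ 2 * n ^ 7 = (n ^ 3) ^ 3 := by ring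
    _ ≤ (4 * D * T) ^ 3 := by gcongr
    _ = 64 * D ^ 3 * T ^ 3 := by ring
    _ ≤ 64 * D ^ 3 * (512 * 10 ^ 14 * n ^ 7) := by gcongr
    _ ≤ 4 * 10 ^ 18 * D ^ 3 * n ^ 7 := by nlinarith [show 0 ≤ D ^ 3 * n ^ 7 by positivity]

open Classical in
theorem card_sq_le_pow_three {K : Type*} [Field K] [Infinite K] (h2K : (2 : K) ≠ 0)
    {A : Finset (K × K)} (hA : A.Nonempty) {D : ℕ}
    (hD : ∀ x ∈ A, (A.image fun a => isoDist a x).card ≤ D)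
    (h1 : ¬ ∃ x, ∀ a ∈ A, a.1 = x) (h2 : ¬ ∃ y, ∀ a ∈ A, a.2 = y)
    (hchar : ∀ j : ℕ, 0 < j → 64 * j ^ 4 ≤ 3 * A.card ^ 3 → (j : K) ≠ 0) :
    (A.card : ℝ) ^ 2 ≤ 4 * 10 ^ 18 * (D : ℝ) ^ 3 := by
  have hD1 : 1 ≤ D := by
    obtain ⟨x, hx⟩ := hA
    exact (Finset.card_pos.mpr ⟨_, Finset.mem_image_of_mem _ hx⟩).trans_le (hD x hx)
  have hD1' : (1 : ℝ) ≤ D := by exact_mod_cast hD1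
  by_cases hn : 4 * D ≤ A.card
  swap
  · have hlt : (A.card : ℝ) ≤ 4 * D := by
      push Not at hn
      exact_mod_cast hn.le
    have hD3 : (D : ℝ) ^ 2 ≤ (D : ℝ) ^ 3 := pow_le_pow_right₀ hD1' (by norm_num)
    calc (A.card : ℝ) ^ 2 ≤ (4 * D) ^ 2 := by gcongr
      _ = 16 * (D : ℝ) ^ 2 := by ring
      _ ≤ 4 * 10 ^ 18 * (D : ℝ) ^ 3 := by nlinarith [sq_nonneg (D : ℝ)]
  have h0 := card_isoDist_eq_zero_le (card_fst_eq_le hD h1) (card_snd_eq_le hD h2)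
  have hP := planarBound hD h1 h2
  obtain ⟨W, hW1, hW2⟩ := exists_card_isosceles_le (A := A)
  set V := ∑ r ∈ distances A, (segments A r).card * (2 * (segments A r).card).sqrt with hV
  have hQ : (sameBisector A).card ≤ 8 * D * A.card ^ 2 + 2 * 10 ^ 7 * V := by
    refine (card_sameBisector_le h0).trans ?_
    have e1 : ∀ r ∈ distances A,
        ((segments A r ×ˢ segments A r).filter fun q => SegRel r q.1 q.2).card ≤
        2 * 10 ^ 7 * ((segments A r).card * (2 * (segments A r).card).sqrt) +
          6 * D * (segments A r).card := by
      intro r hr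
      have hr0 : r ≠ 0 := Finset.ne_of_mem_erase hr
      refine (card_segRel_le hP hr0 h2K fun j hj hjr => hchar j hj ?_).trans (le_of_eq (by ring))
      calc 64 * j ^ 4 = (8 * j ^ 2) ^ 2 := by ring
        _ ≤ (segments A r).card ^ 2 := Nat.pow_le_pow_left hjr 2
        _ ≤ _ := card_segments_sq_le hr0
    have e2 := Finset.sum_le_sum e1
    rw [Finset.sum_add_distrib, ← Finset.mul_sum, ← Finset.mul_sum] at e2
    have e3 := Nat.mul_le_mul_left (6 * D) (sum_card_segments_le (A := A))
    lia
  have hV2 : V ^ 2 ≤ 2 * A.card ^ 3 * (isosceles A).card := by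
    refine (Finset.sum_mul_sq_le_sq_mul_sq _ _ _).trans ?_
    have e1 : ∑ r ∈ distances A, (2 * (segments A r).card).sqrt ^ 2 ≤ 2 * A.card ^ 2 := by
      refine (Finset.sum_le_sum fun r _ => Nat.sqrt_le' _).trans ?_
      rw [← Finset.mul_sum]
      exact Nat.mul_le_mul_left 2 sum_card_segments_le
    refine (Nat.mul_le_mul sum_card_segments_sq_le e1).trans (le_of_eq (by ring))
  have hT := card_pow_three_le_isosceles hD h0 hn
  refine sq_le_pow_three_of_inequalities (T := (isosceles A).card) (W := W)
    (Q := (sameBisector A).card) (V := V) (by exact_mod_cast hA.card_pos) hD1'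
    ?_ ?_ ?_ ?_ ?_ <;> norm_cast

end Conclusion
section Lift

variable {F : Type*} [Field F]

open Classical in
theorem pinnedCount_eq_card_image (A : Finset (F × F)) (x : F × F) :
    pinnedCount A x = (A.image fun a => dist2 a x).card := by
  rw [pinnedCount, ← Finset.coe_image, Set.ncard_coe_finset]

theorem pinnedMax_pos {A : Finset (F × F)} (hA : A.Nonempty) : 0 < pinnedMax A := by
  classical
  obtain ⟨x, hx⟩ := hA
  refine lt_of_lt_of_le ?_ (Finset.le_sup (f := pinnedCount A) hx)
  rw [pinnedCount_eq_card_image]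
  exact Finset.card_pos.mpr ⟨_, Finset.mem_image_of_mem _ hx⟩

/-- The isotropic coordinates attached to a square root `i` of `-1`. -/
def isoCoord {K : Type*} [Field K] [Algebra F K] (i : K) (x : F × F) : K × K :=
  (algebraMap F K x.1 + i * algebraMap F K x.2, algebraMap F K x.1 - i * algebraMap F K x.2)

variable {K : Type*} [Field K] [Algebra F K] {i : K}

theorem isoDist_isoCoord (hi : i * i = -1) (x y : F × F) :
    isoDist (isoCoord i x) (isoCoord i y) = algebraMap F K (dist2 x y) := by
  simp only [isoDist, isoCoord, dist2, map_add, map_sub, map_pow]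
  linear_combination -(algebraMap F K x.2 - algebraMap F K y.2) ^ 2 * hi

theorem isoCoord_injective (h2 : (2 : K) ≠ 0) (hi : i * i = -1) :
    Function.Injective (isoCoord (F := F) i) := by
  intro x y h
  simp only [isoCoord, Prod.mk.injEq] at h
  have hi0 : i ≠ 0 := by
    rintro rfl
    simp at hi
  have e1 : algebraMap F K x.1 = algebraMap F K y.1 := by
    apply mul_left_cancel₀ h2
    linear_combination h.1 + h.2
  have e2 : algebraMap F K x.2 = algebraMap F K y.2 := by
    apply mul_left_cancel₀ (mul_ne_zero h2 hi0)
    linear_combination h.1 - h.2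
  exact Prod.ext ((algebraMap F K).injective e1) ((algebraMap F K).injective e2)

theorem exists_isotropicLine {A : Finset (F × F)} (hA : 1 < A.card) (hi : i * i = -1)
    (h : ∃ z, ∀ a ∈ A, algebraMap F K a.1 + i * algebraMap F K a.2 = z) :
    ∃ L : Set (F × F), IsIsotropicLine L ∧ (A : Set (F × F)) ⊆ L := by
  obtain ⟨z, hz⟩ := h
  obtain ⟨a, ha, b, hb, hab⟩ := Finset.one_lt_card.mp hA
  have hdir : ∀ y ∈ A, algebraMap F K (y - a).1 = -(i * algebraMap F K (y - a).2) := by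
    intro y hy
    simp only [Prod.fst_sub, Prod.snd_sub, map_sub]
    linear_combination hz y hy - hz a ha
  have hv2 : (b - a).2 ≠ 0 := by
    intro h0
    have h1 := hdir b hb
    rw [h0, map_zero, mul_zero, neg_zero, map_eq_zero] at h1
    exact hab (sub_eq_zero.mp (Prod.ext h1 h0)).symm
  refine ⟨_, ⟨a, b - a, fun h0 => hv2 (by rw [h0]; rfl), ?_, rfl⟩, fun y hy => ?_⟩
  · apply (algebraMap F K).injective
    rw [dot, map_add, map_mul, map_mul, hdir b hb, map_zero]
    linear_combination (algebraMap F K (b - a).2) ^ 2 * hi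
  · refine ⟨(y - a).2 / (b - a).2, ?_⟩
    have h2 : (y - a).2 / (b - a).2 * (b - a).2 = (y - a).2 := div_mul_cancel₀ _ hv2
    have h1 : (y - a).2 / (b - a).2 * (b - a).1 = (y - a).1 := by
      apply (algebraMap F K).injective
      rw [map_mul, hdir b hb, hdir y hy]
      linear_combination -i * (map_mul (algebraMap F K) _ _).symm.trans (congrArg _ h2)
    ext
    · rw [Prod.fst_add, Prod.smul_fst, smul_eq_mul, h1, Prod.fst_sub, add_sub_cancel]
    · rw [Prod.snd_add, Prod.smul_snd, smul_eq_mul, h2, Prod.snd_sub, add_sub_cancel]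

theorem card_sq_le_pinnedMax_pow {A : Finset (F × F)} (hA : 1 < A.card) (h2 : (2 : F) ≠ 0)
    (hchar : ∀ j : ℕ, 0 < j → 64 * j ^ 4 ≤ 3 * A.card ^ 3 → (j : F) ≠ 0)
    (hline : ¬ ∃ L : Set (F × F), IsIsotropicLine L ∧ (A : Set (F × F)) ⊆ L) :
    (A.card : ℝ) ^ 2 ≤ 4 * 10 ^ 18 * (pinnedMax A : ℝ) ^ 3 := by
  classical
  obtain ⟨i, hi⟩ := IsAlgClosed.exists_eq_mul_self (-1 : AlgebraicClosure F)
  have hinf : Infinite (AlgebraicClosure F) := IsAlgClosed.instInfinite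
  have hcast : ∀ j : ℕ, (j : F) ≠ 0 → (j : AlgebraicClosure F) ≠ 0 := fun j hj h0 =>
    hj ((algebraMap F (AlgebraicClosure F)).injective (by rw [map_natCast, h0, map_zero]))
  have h2K : (2 : AlgebraicClosure F) ≠ 0 := by exact_mod_cast hcast 2 (by exact_mod_cast h2)
  have hinj := isoCoord_injective (F := F) h2K hi.symm
  have hcard : (A.image (isoCoord i)).card = A.card := Finset.card_image_of_injective _ hinj
  rw [← hcard]
  refine card_sq_le_pow_three h2K (Finset.card_pos.mp (by lia)) (fun x hx => ?_) ?_ ?_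
    fun j hj hjA => hcast j (hchar j hj (by rwa [hcard] at hjA))
  · obtain ⟨y, hy, rfl⟩ := Finset.mem_image.mp hx
    refine le_trans (le_of_eq ?_) (Finset.le_sup (f := pinnedCount A) hy)
    rw [pinnedCount_eq_card_image, Finset.image_image,
      ← Finset.card_image_of_injective _ (algebraMap F (AlgebraicClosure F)).injective,
      Finset.image_image]
    simp only [Function.comp_def, isoDist_isoCoord hi.symm]
  · rintro ⟨z, hz⟩
    exact hline (exists_isotropicLine hA hi.symm
      ⟨z, fun a ha => hz _ (Finset.mem_image_of_mem _ ha)⟩)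
  · rintro ⟨z, hz⟩
    refine hline (exists_isotropicLine (i := -i) hA (by rw [neg_mul_neg, hi])
      ⟨z, fun a ha => ?_⟩)
    rw [← hz _ (Finset.mem_image_of_mem _ ha), isoCoord]
    ring

end Lift

theorem pow_three_le_of_le_rpow {n p : ℕ} (h : (n : ℝ) ≤ (p : ℝ) ^ ((4 : ℝ) / 3)) :
    n ^ 3 ≤ p ^ 4 := by
  have h1 : (n : ℝ) ^ 3 ≤ ((p : ℝ) ^ ((4 : ℝ) / 3)) ^ 3 := by gcongr
  rw [← Real.rpow_mul_natCast (Nat.cast_nonneg _)] at h1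
  norm_num at h1
  exact_mod_cast h1

/-- Pinned distances over a general field: there is an absolute constant `c > 0` such that for
every field `F` and every finite nonempty `A ⊆ F²` (with `|A| ≤ p^(4/3)` if `char F = p > 0`),
either `A` lies on a single isotropic line, or `Δ_pin(A) ≥ c·|A|^(2/3)`. -/
theorem pinned_distances_general_field :
    ∃ c : ℝ, 0 < c ∧
      ∀ (F : Type) [inst : Field F],
        ∀ A : Finset (F × F), A.Nonempty →
          (∀ p : ℕ, p ≠ 0 → CharP F p → (A.card : ℝ) ≤ (p : ℝ) ^ ((4 : ℝ) / 3)) →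
          (∃ L : Set (F × F), IsIsotropicLine L ∧ (A : Set (F × F)) ⊆ L) ∨
            c * (A.card : ℝ) ^ ((2 : ℝ) / 3) ≤ (pinnedMax A : ℝ) := by
  refine ⟨1 / (2 * 10 ^ 6), by positivity, fun F _ A hA hp => ?_⟩
  rw [or_iff_not_imp_left]
  intro hline
  have hD : (1 : ℝ) ≤ pinnedMax A := by exact_mod_cast pinnedMax_pos hA
  suffices h : (A.card : ℝ) ^ 2 ≤ (2 * 10 ^ 6 * (pinnedMax A : ℝ)) ^ 3 by
    have h1 := Real.rpow_le_rpow (by positivity) h (show (0 : ℝ) ≤ 1 / 3 by norm_num)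
    rw [← Real.rpow_natCast, ← Real.rpow_natCast, ← Real.rpow_mul (by positivity),
      ← Real.rpow_mul (by positivity)] at h1
    norm_num at h1
    linarith
  have hD3 : (1 : ℝ) ≤ (pinnedMax A : ℝ) ^ 3 := one_le_pow₀ hD
  have hcard : ∀ p : ℕ, p ≠ 0 → CharP F p → A.card ^ 3 ≤ p ^ 4 := fun p h1 h2 =>
    pow_three_le_of_le_rpow (hp p h1 h2)
  by_cases hn : A.card ≤ 2
  · have hn' : (A.card : ℝ) ^ 2 ≤ 2 ^ 2 := by
      gcongr
      exact_mod_cast hn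
    nlinarith
  have h2 : (2 : F) ≠ 0 := by
    intro h2
    have h3 := hcard 2 two_ne_zero (CharTwo.of_one_ne_zero_of_two_eq_zero one_ne_zero h2)
    have h4 : 3 ^ 3 ≤ A.card ^ 3 := Nat.pow_le_pow_left (by lia) 3
    lia
  have hchar : ∀ j : ℕ, 0 < j → 64 * j ^ 4 ≤ 3 * A.card ^ 3 → (j : F) ≠ 0 := by
    intro j hj hjA h0
    have hdvd := (ringChar.spec F j).mp h0
    have h3 := hcard (ringChar F) (fun h => hj.ne' (by simpa [h] using hdvd)) inferInstance
    have h4 := Nat.pow_le_pow_left (Nat.le_of_dvd hj hdvd) 4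
    have h5 := Nat.pow_pos (n := 4) hj
    lia
  have h := card_sq_le_pinnedMax_pow (by lia) h2 hchar hline
  nlinarith

end Stmt3
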